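/- arXiv:1702.00080 — 2 statements merged into one kernel-verified Lean document; each statement's English description precedes it below -/
import Mathlib

section
/- Let k be a field, let I ⊆ k[x_0,…,x_n] be a saturated Borel monomial ideal with Hilbert polynomial p of degree d < n, and let L^p_n ⊆ k[x_0,…,x_n] be the lexicographic ideal for p. If I ≠ L^p_n, then deg hk_{L^p_n} > deg hk_I, where hk_J denotes the K-polynomial of k[x_0,…,x_n]/J. -/
/-- The polynomial binomial coefficient `C(t+a, b) ∈ ℚ[t]`. -/
noncomputable def polyBinom (a b : ℤ) : Polynomial ℚ :=
  if 0 ≤ b then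
    (Nat.factorial b.toNat : ℚ)⁻¹ •
      (descPochhammer ℚ b.toNat).comp (Polynomial.X + Polynomial.C (a : ℚ))
  else 0

/-- The Macaulay–Hartshorne expression `Σ_{i=0}^d [C(t+i, i+1) − C(t+i−e_i, i+1)]`. -/
noncomputable def mhSum (d : ℕ) (e : Fin (d + 1) → ℤ) : Polynomial ℚ :=
  ∑ i : Fin (d + 1),
    (polyBinom ((i : ℕ) : ℤ) (((i : ℕ) : ℤ) + 1) -
      polyBinom (((i : ℕ) : ℤ) - e i) (((i : ℕ) : ℤ) + 1))

/-- A monomial ideal: an ideal generated by a set of monomials. -/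
def IsMonomialIdeal {k : Type*} [Field k] {N : ℕ} (I : Ideal (MvPolynomial (Fin N) k)) : Prop :=
  ∃ S : Set (Fin N →₀ ℕ), I = Ideal.span ((fun u => MvPolynomial.monomial u (1 : k)) '' S)

/-- `I` is Borel (strongly stable): for every monomial `x^u ∈ I`, every `j` with
`x_j ∣ x^u`, and every `i < j`, the monomial `x^u·x_i/x_j` lies in `I`. -/
def IsBorel {k : Type*} [Field k] {N : ℕ} (I : Ideal (MvPolynomial (Fin N) k)) : Prop :=
  ∀ u : Fin N →₀ ℕ, MvPolynomial.monomial u (1 : k) ∈ I →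
    ∀ j : Fin N, u j ≠ 0 → ∀ i : Fin N, i < j →
      MvPolynomial.monomial (u - Finsupp.single j 1 + Finsupp.single i 1) (1 : k) ∈ I

/-- `I` is saturated with respect to the irrelevant ideal `⟨x_0,…,x_n⟩`: every `f` with
`f·⟨x_0,…,x_n⟩^j ⊆ I` for some `j ≥ 1` lies in `I`. -/
def IsSaturatedIdeal {k : Type*} [Field k] {N : ℕ} (I : Ideal (MvPolynomial (Fin N) k)) : Prop :=
  ∀ f : MvPolynomial (Fin N) k,
    (∃ j : ℕ, 1 ≤ j ∧
      ∀ g ∈ (Ideal.span (Set.range (MvPolynomial.X : Fin N → MvPolynomial (Fin N) k))) ^ j,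
        f * g ∈ I) → f ∈ I

/-- The Hilbert function of `k[x_0,…,x_{N−1}]/I` in degree `i`: the `k`-dimension of the
degree-`i` homogeneous piece modulo the degree-`i` part of `I`. -/
noncomputable def hilbFn {k : Type*} [Field k] {N : ℕ} (I : Ideal (MvPolynomial (Fin N) k))
    (i : ℕ) : ℕ :=
  Module.finrank k
    ((MvPolynomial.homogeneousSubmodule (Fin N) k i) ⧸
      (Submodule.comap (MvPolynomial.homogeneousSubmodule (Fin N) k i).subtype
        (Submodule.restrictScalars k I)))

/-- The sequence `e_0, …, e_d` extended by `e_i := 0` for `i > d`. -/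
def eExt (d : ℕ) (e : Fin (d + 1) → ℤ) (i : ℕ) : ℤ :=
  if h : i ≤ d then e ⟨i, Nat.lt_succ_of_le h⟩ else 0

/-- `a_j := e_j − e_{j+1}` for the extended sequence. -/
def aSeq (d : ℕ) (e : Fin (d + 1) → ℤ) (j : ℕ) : ℕ :=
  (eExt d e j - eExt d e (j + 1)).toNat

/-- The exponent vector of the `m`-th generator (for `0 ≤ m ≤ n−1`) of `L(a_0,…,a_{n−1})`:
for `m < n−1` it is `x_0^{a_{n−1}}⋯x_{m−1}^{a_{n−m}}·x_m^{a_{n−1−m}+1}`, and for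
`m = n−1` it is `x_0^{a_{n−1}}⋯x_{n−2}^{a_1}·x_{n−1}^{a_0}`. -/
noncomputable def lexExp (n : ℕ) (a : ℕ → ℕ) (m : ℕ) : Fin (n + 1) →₀ ℕ :=
  Finsupp.equivFunOnFinite.symm fun t : Fin (n + 1) =>
    if (t : ℕ) < m then a (n - 1 - (t : ℕ))
    else if (t : ℕ) = m then (if m = n - 1 then a 0 else a (n - 1 - m) + 1)
    else 0

/-- The monomial ideal `L(a_0,…,a_{n−1}) ⊆ k[x_0,…,x_n]`. -/
noncomputable def lexIdealGen (k : Type*) [Field k] (n : ℕ) (a : ℕ → ℕ) :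
    Ideal (MvPolynomial (Fin (n + 1)) k) :=
  Ideal.span ((fun m => MvPolynomial.monomial (lexExp n a m) (1 : k)) '' {m : ℕ | m < n})

/-! ### Exponent vectors and strongly stable sets -/

/-- Append a last exponent to an exponent vector. -/
def appendExp {n : ℕ} (v : Fin n → ℕ) (b : ℕ) : Fin (n + 1) → ℕ :=
  Fin.snoc (α := fun _ => ℕ) v b

/-- Drop the last exponent of an exponent vector. -/
def dropLast {n : ℕ} (u : Fin (n + 1) → ℕ) : Fin n → ℕ := fun i => u i.castSucc

section AppendExp

variable {n : ℕ}

@[simp] lemma appendExp_castSucc (v : Fin n → ℕ) (b : ℕ) (i : Fin n) :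
    appendExp v b i.castSucc = v i := by simp [appendExp]

@[simp] lemma appendExp_last (v : Fin n → ℕ) (b : ℕ) : appendExp v b (Fin.last n) = b := by
  simp [appendExp]

@[simp] lemma dropLast_apply (u : Fin (n + 1) → ℕ) (i : Fin n) :
    dropLast u i = u i.castSucc := rfl

@[simp] lemma dropLast_appendExp (v : Fin n → ℕ) (b : ℕ) : dropLast (appendExp v b) = v := by
  ext i; simp

lemma appendExp_dropLast (u : Fin (n + 1) → ℕ) :
    appendExp (dropLast u) (u (Fin.last n)) = u := by
  ext i; refine Fin.lastCases ?_ (fun i => ?_) i <;> simp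

lemma exists_eq_appendExp (u : Fin (n + 1) → ℕ) : ∃ v b, u = appendExp v b :=
  ⟨_, _, (appendExp_dropLast u).symm⟩

lemma appendExp_inj {v w : Fin n → ℕ} {b c : ℕ} :
    appendExp v b = appendExp w c ↔ v = w ∧ b = c := by
  constructor
  · intro h
    exact ⟨by simpa using congrArg dropLast h, by simpa using congrFun h (Fin.last n)⟩
  · rintro ⟨rfl, rfl⟩; rfl

lemma appendExp_le {v w : Fin n → ℕ} {b c : ℕ} :
    appendExp v b ≤ appendExp w c ↔ v ≤ w ∧ b ≤ c := by
  constructor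
  · intro h
    exact ⟨fun i => by simpa using h i.castSucc, by simpa using h (Fin.last n)⟩
  · rintro ⟨h, h'⟩ i
    refine Fin.lastCases ?_ (fun i => ?_) i
    · simpa using h'
    · simpa using h i

lemma appendExp_add (v w : Fin n → ℕ) (b c : ℕ) :
    appendExp (v + w) (b + c) = appendExp v b + appendExp w c := by
  ext i; refine Fin.lastCases ?_ (fun i => ?_) i <;> simp

lemma appendExp_single (i : Fin n) :
    appendExp (Pi.single i 1) 0 = Pi.single i.castSucc 1 := by
  ext j; refine Fin.lastCases ?_ (fun j => ?_) j
  · simp [Fin.castSucc_ne_last]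
  · simp [Pi.single_apply]

lemma appendExp_zero_one : appendExp (0 : Fin n → ℕ) 1 = Pi.single (Fin.last n) 1 := by
  ext j; refine Fin.lastCases ?_ (fun j => ?_) j
  · simp
  · simp

lemma sum_appendExp (v : Fin n → ℕ) (b : ℕ) : ∑ i, appendExp v b i = ∑ i, v i + b := by
  simp [Fin.sum_univ_castSucc]

end AppendExp

/-- Exponents of a Borel (strongly stable) monomial ideal. -/
structure StronglyStable {n : ℕ} (J : Set (Fin n → ℕ)) : Prop where
  upper : IsUpperSet J
  borel : ∀ (u : Fin n → ℕ) (i j : Fin n), i < j → u + Pi.single j 1 ∈ J → u + Pi.single i 1 ∈ J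

/-- Exponents of the ideal obtained by setting the last variable to `1`. -/
def localize {n : ℕ} (J : Set (Fin (n + 1) → ℕ)) : Set (Fin n → ℕ) :=
  {v | ∃ b, appendExp v b ∈ J}

/-- Monomials outside `J` that some power of the last variable carries into `J`. -/
def gap {n : ℕ} (J : Set (Fin (n + 1) → ℕ)) : Set (Fin (n + 1) → ℕ) :=
  {u | u ∉ J ∧ dropLast u ∈ localize J}

section StronglyStable

variable {n : ℕ} {J : Set (Fin (n + 1) → ℕ)}

lemma appendExp_mem_gap {v : Fin n → ℕ} {b : ℕ} :
    appendExp v b ∈ gap J ↔ appendExp v b ∉ J ∧ v ∈ localize J := by simp [gap]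

lemma dropLast_mem_localize {u : Fin (n + 1) → ℕ} (h : u ∈ J) : dropLast u ∈ localize J :=
  ⟨u (Fin.last n), by rwa [appendExp_dropLast]⟩

lemma mem_iff_localize_gap {u : Fin (n + 1) → ℕ} :
    u ∈ J ↔ dropLast u ∈ localize J ∧ u ∉ gap J := by
  constructor
  · intro h
    exact ⟨dropLast_mem_localize h, fun h' => h'.1 h⟩
  · rintro ⟨h, h'⟩
    by_contra h''
    exact h' ⟨h'', h⟩

lemma eq_of_localize_eq_of_gap_eq {J' : Set (Fin (n + 1) → ℕ)} (h : localize J = localize J')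
    (h' : gap J = gap J') : J = J' := by
  ext u; rw [mem_iff_localize_gap, h, h', ← mem_iff_localize_gap]

lemma stronglyStable_localize (hJ : StronglyStable J) : StronglyStable (localize J) where
  upper := by
    rintro v w hvw ⟨b, hb⟩
    exact ⟨b, hJ.upper (appendExp_le.2 ⟨hvw, le_rfl⟩) hb⟩
  borel := by
    rintro u i j hij ⟨b, hb⟩
    refine ⟨b, ?_⟩
    have key : ∀ i, appendExp (u + Pi.single i 1) b
        = appendExp u b + Pi.single i.castSucc 1 := by
      intro i
      rw [← appendExp_single, ← appendExp_add, add_zero]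
    rw [key] at hb ⊢
    exact hJ.borel _ _ _ (by simpa using hij) hb

lemma StronglyStable.appendExp_add_mem (hJ : StronglyStable J) (s : Fin n → ℕ) :
    ∀ (w : Fin n → ℕ) (b : ℕ), appendExp w (b + ∑ i, s i) ∈ J → appendExp (w + s) b ∈ J := by
  induction hs : ∑ i, s i generalizing s with
  | zero =>
    intro w b h
    have : s = 0 := by
      ext i
      exact (Finset.sum_eq_zero_iff.1 hs) i (Finset.mem_univ i)
    simpa [this] using h
  | succ m ih =>
    intro w b h
    have : ∃ i, s i ≠ 0 := by
      by_contra! h0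
      simp [h0] at hs
    obtain ⟨i, hi⟩ := this
    obtain ⟨r, rfl⟩ : ∃ r, s = r + Pi.single i 1 := by
      refine ⟨s - Pi.single i 1, (tsub_add_cancel_of_le fun j => ?_).symm⟩
      by_cases hj : j = i
      · subst hj; simp; omega
      · simp [hj]
    have hr : ∑ i, r i = m := by
      have : ∑ j, (Pi.single i 1 : Fin n → ℕ) j = 1 := by simp
      rw [Finset.sum_congr rfl fun j _ => Pi.add_apply r _ j, Finset.sum_add_distrib, this] at hs
      omega
    have h1 : appendExp (w + r) (b + 1) ∈ J := ih r hr w (b + 1) (by convert h using 2; omega)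
    have h2 := hJ.borel (appendExp (w + r) b) i.castSucc (Fin.last n) (Fin.castSucc_lt_last i)
    rw [← appendExp_zero_one, ← appendExp_single, ← appendExp_add, ← appendExp_add] at h2
    have := h2 (by simpa using h1)
    simpa [add_assoc] using this

lemma sum_tsub_of_le {w v : Fin n → ℕ} (h : w ≤ v) : ∑ i, (v - w) i + ∑ i, w i = ∑ i, v i := by
  rw [← Finset.sum_add_distrib]
  exact Finset.sum_congr rfl fun i _ => by
    have : w i ≤ v i := h i
    rw [Pi.sub_apply]
    omega

lemma eq_of_le_of_sum_eq {w v : Fin n → ℕ} (h : w ≤ v) (h' : ∑ i, v i ≤ ∑ i, w i) : w = v := by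
  by_contra hne
  have : ∃ i, w i < v i := by
    by_contra! h0
    exact hne (le_antisymm h h0)
  obtain ⟨i, hi⟩ := this
  have := Finset.sum_lt_sum (fun i _ => h i) ⟨i, Finset.mem_univ i, hi⟩
  omega

lemma StronglyStable.appendExp_mem_gap_of_le (hJ : StronglyStable J) {u : Fin (n + 1) → ℕ}
    (hu : u ∈ gap J) {w : Fin n → ℕ} (hwu : w ≤ dropLast u) (hw : w ∈ localize J) {b : ℕ}
    (hb : ∑ i, w i + b ≤ ∑ i, u i) : appendExp w b ∈ gap J := by
  obtain ⟨v, c, rfl⟩ := exists_eq_appendExp u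
  rw [dropLast_appendExp] at hwu
  rw [sum_appendExp] at hb
  rw [appendExp_mem_gap] at hu ⊢
  refine ⟨fun h => hu.1 ?_, hw⟩
  have hs := sum_tsub_of_le hwu
  have := hJ.appendExp_add_mem (v - w) w c
    (hJ.upper (appendExp_le.2 ⟨le_rfl, by omega⟩) h)
  rwa [add_tsub_cancel_of_le hwu] at this

lemma finite_sum_le (n M : ℕ) : {u : Fin n → ℕ | ∑ i, u i ≤ M}.Finite := by
  refine (Set.finite_Iic (fun _ : Fin n => M)).subset fun u hu i => ?_
  exact (Finset.single_le_sum (fun _ _ => Nat.zero_le _) (Finset.mem_univ i)).trans hu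

lemma StronglyStable.gap_finite (hJ : StronglyStable J) {M : ℕ}
    (hM : ∀ v ∈ localize J, ∃ w ≤ v, w ∈ localize J ∧ ∑ i, w i ≤ M) :
    (gap J).Finite := by
  have hfin : {w : Fin n → ℕ | w ∈ localize J ∧ ∑ i, w i ≤ M}.Finite :=
    (finite_sum_le n M).subset fun w hw => hw.2
  have hB : ∃ B, ∀ w ∈ {w : Fin n → ℕ | w ∈ localize J ∧ ∑ i, w i ≤ M},
      appendExp w B ∈ J := by
    choose! f hf using fun (w : Fin n → ℕ) (hw : w ∈ localize J) => hw
    obtain ⟨B, hB⟩ := (hfin.image f).bddAbove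
    exact ⟨B, fun w hw => hJ.upper (appendExp_le.2 ⟨le_rfl, hB ⟨w, hw, rfl⟩⟩) (hf w hw.1)⟩
  obtain ⟨B, hB⟩ := hB
  refine (finite_sum_le (n + 1) (M + B)).subset fun u hu => ?_
  obtain ⟨w, hwu, hw, hwM⟩ := hM _ hu.2
  by_contra hlt
  simp only [Set.mem_ofPred_eq, not_le] at hlt
  exact (hJ.appendExp_mem_gap_of_le hu hwu hw (b := B) (by omega)).1 (hB w ⟨hw, hwM⟩)

/-- The column of monomials `w·xₙ^i` for `i < c`. -/
def column (w : Fin n → ℕ) (c : ℕ) : Set (Fin (n + 1) → ℕ) := (appendExp w) '' Set.Iio c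

lemma appendExp_mem_column {w v : Fin n → ℕ} {b c : ℕ} :
    appendExp v b ∈ column w c ↔ v = w ∧ b < c := by
  simp only [column, Set.mem_image, Set.mem_Iio, appendExp_inj]
  constructor
  · rintro ⟨i, h, rfl, rfl⟩; exact ⟨rfl, h⟩
  · rintro ⟨rfl, h⟩; exact ⟨b, h, rfl, rfl⟩

lemma appendExp_injective (w : Fin n → ℕ) : Function.Injective (appendExp w) :=
  fun _ _ h => (appendExp_inj.1 h).2

lemma ncard_column (w : Fin n → ℕ) (c : ℕ) : (column w c).ncard = c := by
  rw [column, Set.ncard_image_of_injective _ (appendExp_injective w)]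
  simp [Set.ncard_eq_toFinset_card']

lemma StronglyStable.column_subset_gap (hJ : StronglyStable J) {u : Fin (n + 1) → ℕ}
    (hu : u ∈ gap J) {w : Fin n → ℕ} (hwu : w ≤ dropLast u) (hw : w ∈ localize J) {c : ℕ}
    (hc : ∑ i, w i + c ≤ ∑ i, u i + 1) : column w c ⊆ gap J := by
  rintro _ ⟨i, hi, rfl⟩
  rw [Set.mem_Iio] at hi
  exact hJ.appendExp_mem_gap_of_le hu hwu hw (by omega)

lemma sum_dropLast_le (u : Fin (n + 1) → ℕ) : ∑ i, dropLast u i ≤ ∑ i, u i := by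
  simp [Fin.sum_univ_castSucc]

lemma StronglyStable.sum_lt_of_mem_gap (hJ : StronglyStable J) (hfin : (gap J).Finite)
    {u : Fin (n + 1) → ℕ} (hu : u ∈ gap J) {w : Fin n → ℕ} (hwu : w ≤ dropLast u)
    (hw : w ∈ localize J) : ∑ i, u i < ∑ i, w i + (gap J).ncard := by
  have h1 := Finset.sum_le_sum (fun i (_ : i ∈ Finset.univ) => hwu i)
  have h2 := sum_dropLast_le u
  have := Set.ncard_le_ncard (hJ.column_subset_gap hu hwu hw
    (c := ∑ i, u i + 1 - ∑ i, w i) (by omega)) hfin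
  rw [ncard_column] at this
  omega

lemma StronglyStable.gap_eq_column (hJ : StronglyStable J) (hfin : (gap J).Finite)
    {u : Fin (n + 1) → ℕ} (hu : u ∈ gap J) {w : Fin n → ℕ} (hwu : w ≤ dropLast u)
    (hw : w ∈ localize J) (h : ∑ i, w i + (gap J).ncard ≤ ∑ i, u i + 1) :
    gap J = column w (gap J).ncard :=
  (Set.eq_of_subset_of_ncard_le (hJ.column_subset_gap hu hwu hw h)
    (by rw [ncard_column]) hfin).symm

end StronglyStable

/-! ### Lexicographic sets -/

/-- Exponent vectors lexicographically at least `a`; these are the exponents of a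
lexicographic ideal. -/
def lexSet {n : ℕ} (a : Fin n → ℕ) : Set (Fin n → ℕ) :=
  {u | u = a ∨ ∃ i, (∀ j < i, a j = u j) ∧ a i < u i}

section LexSet

variable {n : ℕ}

lemma self_mem_lexSet (a : Fin n → ℕ) : a ∈ lexSet a := Or.inl rfl

lemma mem_lexSet_iff_toLex {a u : Fin n → ℕ} : u ∈ lexSet a ↔ toLex a ≤ toLex u := by
  rw [le_iff_eq_or_lt, toLex_inj, eq_comm]; rfl

lemma lexSet_upper (a : Fin n → ℕ) : IsUpperSet (lexSet a) := by
  intro u v huv hu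
  rw [mem_lexSet_iff_toLex] at hu ⊢
  exact hu.trans (Pi.toLex_monotone huv)

lemma mem_lexSet_appendExp {a : Fin n → ℕ} {c : ℕ} {v : Fin n → ℕ} {b : ℕ} :
    appendExp v b ∈ lexSet (appendExp a c) ↔ v ∈ lexSet a ∧ (v = a → c ≤ b) := by
  constructor
  · rintro (h | ⟨i, hi, hi'⟩)
    · obtain ⟨rfl, rfl⟩ := appendExp_inj.1 h
      exact ⟨Or.inl rfl, fun _ => le_rfl⟩
    · induction i using Fin.lastCases with
      | last =>
        have : v = a := by
          ext j
          simpa using (hi j.castSucc (Fin.castSucc_lt_last j)).symm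
        simp only [appendExp_last] at hi'
        exact ⟨Or.inl this, fun _ => hi'.le⟩
      | cast i =>
        simp only [appendExp_castSucc] at hi'
        refine ⟨Or.inr ⟨i, fun j hj => ?_, hi'⟩, ?_⟩
        · simpa using hi j.castSucc (by simpa using hj)
        · rintro rfl
          exact absurd hi' (lt_irrefl _)
  · rintro ⟨rfl | ⟨i, hi, hi'⟩, hc⟩
    · rcases (hc rfl).eq_or_lt with rfl | h
      · exact Or.inl rfl
      · refine Or.inr ⟨Fin.last n, fun j hj => ?_, by simpa using h⟩
        induction j using Fin.lastCases with
        | last => exact absurd hj (lt_irrefl _)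
        | cast j => simp
    · refine Or.inr ⟨i.castSucc, fun j hj => ?_, by simpa using hi'⟩
      induction j using Fin.lastCases with
      | last => exact absurd hj (not_lt.2 (Fin.le_last _))
      | cast j => simpa using hi j (by simpa using hj)

lemma localize_lexSet (a : Fin n → ℕ) (c : ℕ) : localize (lexSet (appendExp a c)) = lexSet a := by
  ext v
  constructor
  · rintro ⟨b, hb⟩
    exact (mem_lexSet_appendExp.1 hb).1
  · intro h
    exact ⟨c, mem_lexSet_appendExp.2 ⟨h, fun _ => le_rfl⟩⟩

lemma gap_lexSet (a : Fin n → ℕ) (c : ℕ) : gap (lexSet (appendExp a c)) = column a c := by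
  ext u
  obtain ⟨v, b, rfl⟩ := exists_eq_appendExp u
  rw [appendExp_mem_gap, localize_lexSet, mem_lexSet_appendExp, appendExp_mem_column]
  constructor
  · rintro ⟨h, h'⟩
    by_contra! h''
    exact h ⟨h', h''⟩
  · rintro ⟨rfl, h⟩
    exact ⟨fun h' => absurd (h'.2 rfl) (not_le.2 h), self_mem_lexSet _⟩

lemma exists_mem_lexSet_le {a g : Fin n → ℕ} (hg : g ∈ lexSet a)
    (hga : ¬ a ≤ g) : ∃ m l : Fin n, m < l ∧ ∃ z : Fin n → ℕ, a = z + Pi.single l 1 ∧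
      z + Pi.single m 1 ∈ lexSet a ∧ ∃ w ≤ g, w ∈ lexSet a ∧ w ≤ z + Pi.single m 1 := by
  rcases hg with rfl | ⟨m, hm, hm'⟩
  · exact absurd le_rfl hga
  have : ∃ l, g l < a l := by
    by_contra! h
    exact hga h
  obtain ⟨l, hl⟩ := this
  have hml : m < l := by
    rcases lt_trichotomy l m with h | h | h
    · have := hm l h; omega
    · subst h; omega
    · exact h
  have hz : ∀ j, a j = (a - Pi.single l 1 : Fin n → ℕ) j + (Pi.single l 1 : Fin n → ℕ) j := by
    intro j
    by_cases hj : j = l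
    · subst hj; simp; omega
    · simp [hj]
  set z : Fin n → ℕ := a - Pi.single l 1 with hzdef
  have hzm : z m = a m := by simp [hzdef, hml.ne]
  have hzj : ∀ j < m, z j = a j := fun j hj => by simp [hzdef, (hj.trans hml).ne]
  refine ⟨m, l, hml, z, funext hz, Or.inr ⟨m, fun j hj => ?_, ?_⟩,
    fun j => if j < m then a j else if j = m then a m + 1 else 0, fun j => ?_,
    Or.inr ⟨m, fun j hj => by simp [hj], by simp⟩, fun j => ?_⟩
  · simp [hzj j hj, hj.ne]
  · simp [hzm]
  · dsimp only
    split_ifs with h1 h2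
    · exact (hm j h1).le
    · subst h2; exact hm'
    · exact Nat.zero_le _
  · dsimp only
    split_ifs with h1 h2
    · simp [hzj j h1]
    · subst h2; simp [hzm]
    · exact Nat.zero_le _

lemma StronglyStable.eq_lexSet {J : Set (Fin (n + 1) → ℕ)} (hJ : StronglyStable J)
    (hfin : (gap J).Finite) {a : Fin n → ℕ} (ha : localize J = lexSet a)
    {u : Fin (n + 1) → ℕ} (hu : u ∈ gap J) {g : Fin n → ℕ} (hgu : g ≤ dropLast u)
    (hg : g ∈ lexSet a) (hga : ∑ i, g i ≤ ∑ i, a i)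
    (h : ∑ i, a i + (gap J).ncard ≤ ∑ i, u i + 1) :
    J = lexSet (appendExp a (gap J).ncard) := by
  have hcol := hJ.gap_eq_column hfin hu hgu (ha ▸ hg) (by omega)
  suffices g = a by
    subst this
    refine eq_of_localize_eq_of_gap_eq (by rw [localize_lexSet, ha]) (by rw [gap_lexSet, ← hcol])
  have hmin : ∀ w ≤ g, w ∈ lexSet a → w = g := by
    intro w hwg hw
    have hs := Finset.sum_le_sum (fun i (_ : i ∈ Finset.univ) => hwg i)
    have hs' := Finset.sum_le_sum (fun i (_ : i ∈ Finset.univ) => hgu i)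
    have h1 := hJ.appendExp_mem_gap_of_le hu (hwg.trans hgu) (ha ▸ hw) (b := 0)
      (by have := sum_dropLast_le u; omega)
    rw [hcol, appendExp_mem_column] at h1
    exact h1.1
  have hgeq : ∑ i, g i = ∑ i, a i := by
    have := hJ.sum_lt_of_mem_gap hfin hu hgu (ha ▸ hg)
    omega
  by_contra hne
  by_cases hag : a ≤ g
  · exact hne (eq_of_le_of_sum_eq hag hgeq.le).symm
  obtain ⟨m, l, hml, z, haz, hz, w, hwg, hw, hwz⟩ := exists_mem_lexSet_le hg hag
  obtain rfl := hmin w hwg hw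
  have hsum : ∑ i, (z + Pi.single m 1 : Fin n → ℕ) i = ∑ i, a i := by
    rw [haz]; simp [Finset.sum_add_distrib]
  have hzw := eq_of_le_of_sum_eq hwz (by omega)
  by_cases hmem : appendExp a 0 ∈ J
  · have h1 : appendExp w 0 ∉ J := by
      refine (hJ.appendExp_mem_gap_of_le hu hgu (ha ▸ hg) (b := 0) ?_).1
      have hs' := Finset.sum_le_sum (fun i (_ : i ∈ Finset.univ) => hgu i)
      have := sum_dropLast_le u
      omega
    apply h1
    have key : ∀ i, appendExp (z + Pi.single i 1) 0
        = appendExp z 0 + Pi.single i.castSucc 1 := by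
      intro i
      rw [← appendExp_single, ← appendExp_add, add_zero]
    rw [hzw, key]
    refine hJ.borel _ _ l.castSucc (by simpa using hml) ?_
    rw [← key, ← haz]
    exact hmem
  · have : appendExp a 0 ∈ gap J := appendExp_mem_gap.2 ⟨hmem, ha ▸ self_mem_lexSet a⟩
    rw [hcol, appendExp_mem_column] at this
    exact hne this.1.symm

end LexSet

/-! ### Counting monomials by degree -/

open PowerSeries in
/-- The generating function counting exponent vectors in `S` by degree. -/
noncomputable def degSeries {n : ℕ} (S : Set (Fin n → ℕ)) : PowerSeries ℤ :=
  mk fun t => (({u | u ∈ S ∧ ∑ i, u i = t} : Set (Fin n → ℕ)).ncard : ℤ)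

section DegSeries

open PowerSeries

variable {n : ℕ}

lemma coeff_degSeries (S : Set (Fin n → ℕ)) (t : ℕ) :
    coeff t (degSeries S) = (({u | u ∈ S ∧ ∑ i, u i = t} : Set (Fin n → ℕ)).ncard : ℤ) := by
  simp [degSeries]

lemma finite_of_sum_le {S : Set (Fin n → ℕ)} (t : ℕ) (h : ∀ u ∈ S, ∑ i, u i ≤ t) : S.Finite :=
  (finite_sum_le n t).subset h

lemma coeff_degSeries_eq_zero {S : Set (Fin n → ℕ)} {t : ℕ} (h : ∀ u ∈ S, ∑ i, u i ≠ t) :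
    coeff t (degSeries S) = 0 := by
  rw [coeff_degSeries]
  have : {u | u ∈ S ∧ ∑ i, u i = t} = ∅ := by
    ext u
    simp only [Set.mem_ofPred_eq, Set.mem_empty_iff_false, iff_false]
    exact fun hu => h u hu.1 hu.2
  simp [this]

lemma degSeries_union {S T : Set (Fin n → ℕ)} (h : Disjoint S T) :
    degSeries (S ∪ T) = degSeries S + degSeries T := by
  ext t
  rw [map_add, coeff_degSeries, coeff_degSeries, coeff_degSeries, ← Nat.cast_add,
    ← Set.ncard_union_eq ?_ (finite_of_sum_le t fun u hu => hu.2.le)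
      (finite_of_sum_le t fun u hu => hu.2.le)]
  · congr 2
    ext u
    simp only [Set.mem_ofPred_eq, Set.mem_union]
    tauto
  · exact h.mono (fun u hu => hu.1) (fun u hu => hu.1)

@[simp] lemma degSeries_empty : degSeries (∅ : Set (Fin n → ℕ)) = 0 := by
  ext t
  rw [coeff_degSeries_eq_zero (by simp), map_zero]

lemma one_sub_X_mul_degSeries_cylinder (S : Set (Fin n → ℕ)) :
    (1 - X) * degSeries {u : Fin (n + 1) → ℕ | dropLast u ∈ S} = degSeries S := by
  have himg : ∀ t, (((fun v => appendExp v 0) '' {u | u ∈ S ∧ ∑ i, u i = t} :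
      Set (Fin (n + 1) → ℕ))).ncard = ({u | u ∈ S ∧ ∑ i, u i = t} : Set (Fin n → ℕ)).ncard :=
    fun t => Set.ncard_image_of_injective _ fun v w h => (appendExp_inj.1 h).1
  ext t
  rw [sub_mul, one_mul, map_sub]
  cases t with
  | zero =>
    rw [coeff_zero_X_mul, sub_zero, coeff_degSeries, coeff_degSeries, ← himg]
    congr 2
    ext u
    obtain ⟨v, b, rfl⟩ := exists_eq_appendExp u
    simp only [Set.mem_ofPred_eq, Set.mem_image, dropLast_appendExp, sum_appendExp, appendExp_inj]
    constructor
    · rintro ⟨h, h'⟩; exact ⟨v, ⟨h, by omega⟩, rfl, by omega⟩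
    · rintro ⟨_, ⟨h, h'⟩, rfl, rfl⟩; exact ⟨h, by omega⟩
  | succ t =>
    rw [coeff_succ_X_mul, coeff_degSeries, coeff_degSeries, coeff_degSeries, ← himg,
      sub_eq_iff_eq_add, ← Nat.cast_add]
    have hinj : Function.Injective
        (fun u : Fin (n + 1) → ℕ => u + appendExp 0 1) := add_left_injective _
    rw [← Set.ncard_image_of_injective
      {u : Fin (n + 1) → ℕ | u ∈ {u | dropLast u ∈ S} ∧ ∑ i, u i = t} hinj,
      ← Set.ncard_union_eq ?_ ((finite_of_sum_le (t + 1) fun u hu => hu.2.le).image _)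
        ((finite_of_sum_le t fun u hu => hu.2.le).image _)]
    · congr 2
      ext u
      obtain ⟨v, b, rfl⟩ := exists_eq_appendExp u
      simp only [Set.mem_ofPred_eq, Set.mem_image, dropLast_appendExp, sum_appendExp,
        appendExp_inj, Set.mem_union]
      constructor
      · rintro ⟨h, h'⟩
        cases b with
        | zero => exact Or.inl ⟨v, ⟨h, by omega⟩, rfl, rfl⟩
        | succ b =>
          exact Or.inr ⟨appendExp v b, ⟨by simpa using h, by rw [sum_appendExp]; omega⟩,
            by rw [← appendExp_add, add_zero]⟩
      · rintro (⟨_, ⟨h, h'⟩, rfl, rfl⟩ | ⟨w, ⟨h, h'⟩, hw⟩)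
        · exact ⟨h, by omega⟩
        · obtain ⟨w, c, rfl⟩ := exists_eq_appendExp w
          rw [← appendExp_add, appendExp_inj, add_zero] at hw
          obtain ⟨rfl, rfl⟩ := hw
          rw [sum_appendExp] at h'
          exact ⟨by simpa using h, by omega⟩
    · rw [Set.disjoint_left]
      rintro _ ⟨v, -, rfl⟩ ⟨w, -, hw⟩
      have := congrFun hw (Fin.last n)
      simp at this

lemma one_sub_X_mul_degSeries_compl (J : Set (Fin (n + 1) → ℕ)) :
    (1 - X) * degSeries Jᶜ = degSeries (localize J)ᶜ + (1 - X) * degSeries (gap J) := by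
  rw [← one_sub_X_mul_degSeries_cylinder (localize J)ᶜ, ← mul_add, ← degSeries_union]
  · congr 2
    ext u
    simp only [Set.mem_compl_iff, mem_iff_localize_gap (J := J), Set.mem_union, Set.mem_ofPred_eq]
    tauto
  · rw [Set.disjoint_left]
    intro u hu hu'
    exact hu hu'.2

lemma one_sub_X_pow_mul_degSeries_compl (J : Set (Fin (n + 1) → ℕ)) :
    (1 - X) ^ (n + 1) * degSeries Jᶜ =
      (1 - X) ^ n * degSeries (localize J)ᶜ + (1 - X) ^ (n + 1) * degSeries (gap J) := by
  linear_combination (1 - X) ^ n * one_sub_X_mul_degSeries_compl J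

lemma column_truncate (w : Fin n → ℕ) (c t : ℕ) :
    {u | u ∈ column w c ∧ ∑ i, u i < t} = column w (min c (t - ∑ i, w i)) := by
  ext u
  obtain ⟨v, b, rfl⟩ := exists_eq_appendExp u
  simp only [Set.mem_ofPred_eq, appendExp_mem_column, sum_appendExp, lt_min_iff]
  constructor
  · rintro ⟨⟨rfl, h⟩, h'⟩; exact ⟨rfl, h, by omega⟩
  · rintro ⟨rfl, h, h'⟩; exact ⟨⟨rfl, h⟩, by omega⟩

lemma degSeries_column (w : Fin n → ℕ) (c : ℕ) :
    degSeries (column w c) = ∑ i ∈ Finset.range c, X ^ (∑ j, w j + i) := by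
  induction c with
  | zero => simp [column]
  | succ c ih =>
    have : column w (c + 1) = column w c ∪ {appendExp w c} := by
      ext u
      obtain ⟨v, b, rfl⟩ := exists_eq_appendExp u
      simp only [appendExp_mem_column, Set.mem_union, Set.mem_singleton_iff, appendExp_inj]
      constructor
      · rintro ⟨rfl, h⟩
        rcases Nat.lt_succ_iff_lt_or_eq.1 h with h | h
        · exact Or.inl ⟨rfl, h⟩
        · exact Or.inr ⟨rfl, h⟩
      · rintro (⟨rfl, h⟩ | ⟨rfl, rfl⟩)
        · exact ⟨rfl, by omega⟩
        · exact ⟨rfl, by omega⟩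
    rw [this, degSeries_union, ih, Finset.sum_range_succ]
    · congr 1
      ext t
      rw [coeff_degSeries, coeff_X_pow]
      split_ifs with h
      · have : {u | u ∈ ({appendExp w c} : Set (Fin (n + 1) → ℕ)) ∧ ∑ i, u i = t}
            = {appendExp w c} := by
          ext u
          simp only [Set.mem_singleton_iff, Set.mem_ofPred_eq, and_iff_left_iff_imp]
          rintro rfl
          rw [sum_appendExp, h]
        rw [this, Set.ncard_singleton, Nat.cast_one]
      · rw [← coeff_degSeries]
        refine coeff_degSeries_eq_zero ?_
        rintro _ rfl
        rw [sum_appendExp]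
        exact fun h' => h h'.symm
    · rw [Set.disjoint_singleton_right, appendExp_mem_column]
      simp

lemma coe_sum_X_pow_eq_degSeries_column (w : Fin n → ℕ) (c : ℕ) :
    ((∑ i ∈ Finset.range c, Polynomial.X ^ (∑ j, w j + i) : Polynomial ℤ) : PowerSeries ℤ) =
      degSeries (column w c) := by
  rw [degSeries_column, ← Polynomial.coeToPowerSeries.ringHom_apply, map_sum]
  simp

lemma one_sub_X_mul_degSeries_column (w : Fin n → ℕ) (c : ℕ) :
    (1 - X) * degSeries (column w c) = X ^ (∑ j, w j) - X ^ (∑ j, w j + c) := by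
  rw [degSeries_column]
  simp_rw [pow_add]
  rw [← Finset.mul_sum, mul_left_comm, mul_neg_geom_sum]
  ring

lemma sum_coeff_degSeries (S : Set (Fin n → ℕ)) (t : ℕ) :
    ∑ s ∈ Finset.range t, coeff s (degSeries S) =
      (({u | u ∈ S ∧ ∑ i, u i < t} : Set (Fin n → ℕ)).ncard : ℤ) := by
  induction t with
  | zero => simp
  | succ t ih =>
    rw [Finset.sum_range_succ, ih, coeff_degSeries, ← Nat.cast_add,
      ← Set.ncard_union_eq ?_ (finite_of_sum_le t fun u hu => hu.2.le)
      (finite_of_sum_le t fun u hu => hu.2.le)]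
    · congr 2
      ext u
      simp only [Set.mem_ofPred_eq, Set.mem_union, Nat.lt_succ_iff_lt_or_eq]
      tauto
    · rw [Set.disjoint_left]
      intro u hu hu'
      exact hu.2.ne hu'.2

lemma coeff_one_sub_X_pow_mul_of_le {A : PowerSeries ℤ} {N : ℕ} (hA : ∀ t, N ≤ t → coeff t A = 0)
    (m : ℕ) : ∀ t, N + m ≤ t → coeff t ((1 - X) ^ m * A) = 0 := by
  induction m with
  | zero => intro t ht; simpa using hA t (by omega)
  | succ m ih =>
    intro t ht
    obtain ⟨t, rfl⟩ : ∃ s, t = s + 1 := ⟨t - 1, by omega⟩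
    rw [pow_succ', mul_assoc, sub_mul, one_mul, map_sub, coeff_succ_X_mul, ih t (by omega),
      ih (t + 1) (by omega), sub_zero]

lemma coeff_one_sub_X_pow_mul_top {A : PowerSeries ℤ} {N : ℕ} (hA : ∀ t, N < t → coeff t A = 0)
    (m : ℕ) : coeff (N + m) ((1 - X) ^ m * A) = (-1) ^ m * coeff N A := by
  induction m with
  | zero => simp
  | succ m ih =>
    rw [pow_succ', mul_assoc, sub_mul, one_mul, map_sub, ← add_assoc, coeff_succ_X_mul, ih,
      coeff_one_sub_X_pow_mul_of_le (N := N + 1) hA m _ (by omega)]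
    ring

lemma exists_one_sub_X_mul_eq (A : PowerSeries ℤ) :
    ∃ Q : PowerSeries ℤ, (1 - X) * Q = A ∧
      ∀ t, coeff t Q = ∑ s ∈ Finset.range (t + 1), coeff s A := by
  refine ⟨mk fun t => ∑ s ∈ Finset.range (t + 1), coeff s A, ?_, fun t => by rw [coeff_mk]⟩
  ext t
  rw [sub_mul, one_mul, map_sub]
  cases t with
  | zero => simp
  | succ t => rw [coeff_succ_X_mul, coeff_mk, coeff_mk, Finset.sum_range_succ _ (t + 1)]; ring

lemma one_sub_X_ne_zero : (1 - X : PowerSeries ℤ) ≠ 0 := by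
  intro h
  simpa using congrArg constantCoeff h

end DegSeries

/-! ### Numerators for lexicographic sets -/

section Lex

open PowerSeries

lemma lexSet_of_subsingleton (a : Fin 0 → ℕ) : lexSet a = Set.univ :=
  Set.eq_univ_of_forall fun _ => Or.inl (Subsingleton.elim _ _)

lemma coeff_lexSet_eq_zero {n : ℕ} (a : Fin n → ℕ) : ∀ t, ∑ i, a i + n ≤ t →
    coeff t ((1 - X) ^ n * degSeries (lexSet a)ᶜ) = 0 := by
  induction n with
  | zero => intro t _; simp [lexSet_of_subsingleton]
  | succ n ih =>
    intro t ht
    obtain ⟨a, c, rfl⟩ := exists_eq_appendExp a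
    rw [sum_appendExp] at ht
    rw [one_sub_X_pow_mul_degSeries_compl, localize_lexSet, gap_lexSet, map_add,
      ih a t (by omega), zero_add]
    refine coeff_one_sub_X_pow_mul_of_le (N := ∑ i, a i + c) (fun s hs => ?_) _ _ (by omega)
    refine coeff_degSeries_eq_zero fun u hu => ?_
    obtain ⟨v, b, rfl⟩ := exists_eq_appendExp u
    obtain ⟨rfl, hb⟩ := appendExp_mem_column.1 hu
    rw [sum_appendExp]
    omega

lemma exists_coeff_lexSet_ne_zero {n : ℕ} (a : Fin n → ℕ) (ha : a ≠ 0) :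
    ∃ j < n, (∀ i : Fin n, n ≤ i + j → a i = 0) ∧ ∃ t, t + j + 1 = ∑ i, a i + n ∧
      coeff t ((1 - X) ^ n * degSeries (lexSet a)ᶜ) ≠ 0 := by
  induction n with
  | zero => exact absurd (Subsingleton.elim _ _) ha
  | succ n ih =>
    obtain ⟨a, c, rfl⟩ := exists_eq_appendExp a
    rw [sum_appendExp, one_sub_X_pow_mul_degSeries_compl, localize_lexSet, gap_lexSet]
    cases c with
    | zero =>
      obtain ⟨j, hj, hz, t, ht, hne⟩ := ih a (by
        rintro rfl
        apply ha
        ext i; refine Fin.lastCases ?_ (fun i => ?_) i <;> simp)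
      refine ⟨j + 1, by omega, fun i hi => ?_, t, by omega, ?_⟩
      · induction i using Fin.lastCases with
        | last => simp
        | cast i => simpa using hz i (by simp at hi; omega)
      · simpa [column] using hne
    | succ c =>
      refine ⟨0, by omega, fun i hi => absurd i.2 (by omega), ∑ i, a i + c + (n + 1), by omega, ?_⟩
      rw [map_add, coeff_lexSet_eq_zero a _ (by omega), zero_add, coeff_one_sub_X_pow_mul_top]
      · rw [degSeries_column, Finset.sum_range_succ, map_add, coeff_X_pow_self, map_sum,
          Finset.sum_eq_zero, zero_add, mul_one]
        · exact pow_ne_zero _ (by norm_num)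
        · intro i hi
          rw [Finset.mem_range] at hi
          rw [coeff_X_pow, if_neg (by omega)]
      · intro t ht
        rw [degSeries_column, map_sum, Finset.sum_eq_zero]
        intro i hi
        rw [Finset.mem_range] at hi
        rw [coeff_X_pow, if_neg (by omega)]

/-- A lexicographic set is determined by its Hilbert polynomial. -/
lemma lexSet_injective_of_series {n : ℕ} (a b : Fin n → ℕ) (P : Polynomial ℤ)
    (h : degSeries (lexSet a)ᶜ = degSeries (lexSet b)ᶜ + (1 - X) * (P : PowerSeries ℤ)) :
    a = b := by
  induction n generalizing P with
  | zero => exact Subsingleton.elim _ _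
  | succ n ih =>
    obtain ⟨a, c, rfl⟩ := exists_eq_appendExp a
    obtain ⟨b, c', rfl⟩ := exists_eq_appendExp b
    have h1 := congrArg (fun s => (1 - X) * s) h
    simp only [mul_add, one_sub_X_mul_degSeries_compl, localize_lexSet, gap_lexSet] at h1
    have hab : a = b := by
      refine ih a b ((1 - Polynomial.X) * P + ∑ i ∈ Finset.range c', Polynomial.X ^ (∑ j, b j + i)
        - ∑ i ∈ Finset.range c, Polynomial.X ^ (∑ j, a j + i)) ?_
      push_cast [coe_sum_X_pow_eq_degSeries_column]
      linear_combination h1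
    subst hab
    have h2 : ((∑ i ∈ Finset.range c, Polynomial.X ^ (∑ j, a j + i) : Polynomial ℤ)) =
        ∑ i ∈ Finset.range c', Polynomial.X ^ (∑ j, a j + i) + (1 - Polynomial.X) * P := by
      rw [← Polynomial.coe_inj (R := ℤ)]
      push_cast [coe_sum_X_pow_eq_degSeries_column]
      refine mul_left_cancel₀ one_sub_X_ne_zero ?_
      linear_combination h1
    have h3 := congrArg (Polynomial.eval 1) h2
    simp [Polynomial.eval_finsetSum] at h3
    rw [h3]

end Lex

/-! ### Comparison of a strongly stable set with its lexicographic counterpart -/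

section Comparison

open PowerSeries

variable {n : ℕ}

lemma exists_minimal_le {J : Set (Fin n → ℕ)} {u : Fin n → ℕ} (hu : u ∈ J) :
    ∃ w ≤ u, w ∈ J ∧ ∀ v ≤ w, v ∈ J → v = w := by
  induction hs : ∑ i, u i using Nat.strong_induction_on generalizing u with
  | _ s ih =>
    by_cases h : ∀ v ≤ u, v ∈ J → v = u
    · exact ⟨u, le_rfl, hu, h⟩
    · push Not at h
      obtain ⟨v, hvu, hv, hne⟩ := h
      have hlt : ∑ i, v i < s := by
        by_contra hlt
        exact hne (eq_of_le_of_sum_eq hvu (by omega))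
      obtain ⟨w, hwv, hw⟩ := ih _ hlt hv rfl
      exact ⟨w, hwv.trans hvu, hw⟩

lemma exists_eq_add_single_of_ne {v w : Fin n → ℕ} (h : v ≤ w) (hne : v ≠ w) :
    ∃ z i, w = z + Pi.single i 1 ∧ v ≤ z := by
  have : ∃ i, v i < w i := by
    by_contra! h0
    exact hne (le_antisymm h h0)
  obtain ⟨i, hi⟩ := this
  refine ⟨w - Pi.single i 1, i, (tsub_add_cancel_of_le fun j => ?_).symm, fun j => ?_⟩
  · by_cases hj : j = i
    · subst hj; simp; omega
    · simp [hj]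
  · by_cases hj : j = i
    · subst hj; simp; omega
    · simpa [hj] using h j

/-- A minimal element of a strongly stable set either comes from a minimal element of the
localization or sits directly above the gap. -/
lemma StronglyStable.minimal_cases {J : Set (Fin (n + 1) → ℕ)} (hJ : StronglyStable J)
    {w : Fin (n + 1) → ℕ} (hw : w ∈ J) (hmin : ∀ v ≤ w, v ∈ J → v = w) :
    (∃ u ∈ gap J, ∑ i, w i = ∑ i, u i + 1) ∨
      ∀ v ≤ dropLast w, v ∈ localize J → ∑ i, w i = ∑ i, v i := by
  obtain ⟨x, b, rfl⟩ := exists_eq_appendExp w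
  cases b with
  | succ b =>
    refine Or.inl ⟨appendExp x b, appendExp_mem_gap.2 ⟨fun h => ?_, ⟨b + 1, hw⟩⟩, ?_⟩
    · have := (appendExp_inj.1 (hmin _ (appendExp_le.2 ⟨le_rfl, by omega⟩) h)).2
      omega
    · rw [sum_appendExp, sum_appendExp]; omega
  | zero =>
    rw [or_iff_not_imp_left]
    intro hno v hvx hv
    rw [dropLast_appendExp] at hvx
    by_cases hvx' : v = x
    · rw [hvx', sum_appendExp, add_zero]
    obtain ⟨z, i, rfl, hvz⟩ := exists_eq_add_single_of_ne hvx hvx'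
    have hsum : ∑ j, (z + Pi.single i 1 : Fin n → ℕ) j = ∑ j, z j + 1 := by
      simp [Finset.sum_add_distrib]
    refine absurd ⟨appendExp z 0, appendExp_mem_gap.2 ⟨fun h => ?_, ?_⟩, ?_⟩ hno
    · have := (appendExp_inj.1 (hmin _ (appendExp_le.2 ⟨le_self_add, le_rfl⟩) h)).1
      rw [← this] at hsum
      omega
    · exact (stronglyStable_localize hJ).upper hvz hv
    · rw [sum_appendExp, sum_appendExp, hsum]

lemma sum_range_eq_of_le {Q : PowerSeries ℤ} {N : ℕ} (hQ : ∀ t, N ≤ t + 1 → coeff t Q = 0)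
    {t : ℕ} (ht : N ≤ t) :
    ∑ s ∈ Finset.range t, coeff s Q = ∑ s ∈ Finset.range N, coeff s Q := by
  symm
  refine Finset.sum_subset (Finset.range_mono ht) fun s _ hs => hQ s ?_
  rw [Finset.mem_range] at hs
  omega

/-- The inductive step for the nonnegativity of the difference of Hilbert functions. -/
lemma StronglyStable.exists_series_eq {J : Set (Fin (n + 1) → ℕ)} (hJ : StronglyStable J)
    {a : Fin n → ℕ}
    (hgen : ∀ u ∈ localize J, ∃ w ≤ u, w ∈ localize J ∧ ∑ i, w i ≤ ∑ i, a i)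
    {Q : PowerSeries ℤ} (hQ : degSeries (localize J)ᶜ = degSeries (lexSet a)ᶜ + (1 - X) * Q)
    (hQ0 : ∀ t, 0 ≤ coeff t Q) (hQz : ∀ t, ∑ i, a i ≤ t + 1 → coeff t Q = 0)
    {κ : ℕ} (hκ : (κ : ℤ) = ∑ s ∈ Finset.range (∑ i, a i), coeff s Q) :
    ∃ Q' : PowerSeries ℤ, degSeries Jᶜ =
        degSeries (lexSet (appendExp a ((gap J).ncard + κ)))ᶜ + (1 - X) * Q' ∧
      (∀ t, 0 ≤ coeff t Q') ∧
      ∀ t, ∑ i, appendExp a ((gap J).ncard + κ) i ≤ t + 1 → coeff t Q' = 0 := by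
  have hfin := hJ.gap_finite hgen
  set c := (gap J).ncard with hc
  set L := lexSet (appendExp a (c + κ)) with hL
  have hloc : localize L = lexSet a := localize_lexSet _ _
  have hgap : gap L = column a (c + κ) := gap_lexSet _ _
  obtain ⟨Q', hQ', hcoef⟩ :=
    exists_one_sub_X_mul_eq (Q + degSeries (gap J) - degSeries (gap L))
  have hcoef' : ∀ t, coeff t Q' = ∑ s ∈ Finset.range (t + 1), coeff s Q
      + (({u | u ∈ gap J ∧ ∑ i, u i < t + 1} : Set (Fin (n + 1) → ℕ)).ncard : ℤ)
      - (min (c + κ) (t + 1 - ∑ i, a i) : ℕ) := by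
    intro t
    simp only [hcoef, map_add, map_sub, Finset.sum_add_distrib, Finset.sum_sub_distrib,
      sum_coeff_degSeries]
    rw [hgap, column_truncate, ncard_column]
  have hbound : ∀ u ∈ gap J, ∑ i, u i < ∑ i, a i + c := by
    intro u hu
    obtain ⟨w, hwu, hw, hwa⟩ := hgen _ hu.2
    have := hJ.sum_lt_of_mem_gap hfin hu hwu hw
    omega
  have hall : ∀ t, (∀ u ∈ gap J, ∑ i, u i < t) →
      ({u | u ∈ gap J ∧ ∑ i, u i < t} : Set (Fin (n + 1) → ℕ)).ncard = c := by
    intro t ht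
    rw [hc]
    congr 1
    ext u
    exact ⟨fun h => h.1, fun h => ⟨h, ht u h⟩⟩
  refine ⟨Q', ?_, fun t => ?_, fun t ht => ?_⟩
  · refine mul_left_cancel₀ one_sub_X_ne_zero ?_
    rw [one_sub_X_mul_degSeries_compl, mul_add, one_sub_X_mul_degSeries_compl, hQ', hloc, hQ]
    ring
  · rw [hcoef']
    rcases lt_or_ge t (∑ i, a i) with hlt | hge
    · have h1 : 0 ≤ ∑ s ∈ Finset.range (t + 1), coeff s Q := Finset.sum_nonneg fun s _ => hQ0 s
      have h2 : min (c + κ) (t + 1 - ∑ i, a i) = 0 := by omega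
      rw [h2, Nat.cast_zero, sub_zero]
      exact add_nonneg h1 (Nat.cast_nonneg _)
    · rw [sum_range_eq_of_le hQz (by omega), ← hκ]
      by_cases h : ∀ u ∈ gap J, ∑ i, u i < t + 1
      · rw [hall _ h]
        omega
      · push Not at h
        obtain ⟨u, hu, hut⟩ := h
        obtain ⟨w, hwu, hw, hwa⟩ := hgen _ hu.2
        have hsub : column w (t + 1 - ∑ i, w i) ⊆ {u | u ∈ gap J ∧ ∑ i, u i < t + 1} := by
          intro x hx
          refine ⟨hJ.column_subset_gap hu hwu hw (by omega) hx, ?_⟩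
          obtain ⟨v, b, rfl⟩ := exists_eq_appendExp x
          obtain ⟨rfl, hb⟩ := appendExp_mem_column.1 hx
          rw [sum_appendExp]
          omega
        have := Set.ncard_le_ncard hsub (hfin.subset fun u hu => hu.1)
        rw [ncard_column] at this
        omega
  · rw [sum_appendExp] at ht
    rw [hcoef', sum_range_eq_of_le hQz (by omega), ← hκ,
      hall _ fun u hu => (hbound u hu).trans_le (by omega)]
    omega

/-- A nonempty strongly stable set `J` has a lexicographic counterpart `lexSet a` with the same
Hilbert polynomial. The difference of Hilbert functions is nonnegative and vanishes from degree
`∑ a - 1` on, `J` is generated in degree at most `∑ a`, and if `J` differs from `lexSet a` then it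
is generated in degree less than `∑ a` and its `K`-polynomial has smaller degree. -/
theorem StronglyStable.exists_lexSet {J : Set (Fin n → ℕ)} (hJ : StronglyStable J)
    (hne : J.Nonempty) : ∃ a : Fin n → ℕ,
      (∃ Q : PowerSeries ℤ, degSeries Jᶜ = degSeries (lexSet a)ᶜ + (1 - X) * Q ∧
        (∀ t, 0 ≤ coeff t Q) ∧ ∀ t, ∑ i, a i ≤ t + 1 → coeff t Q = 0) ∧
      (∀ u ∈ J, ∃ w ≤ u, w ∈ J ∧ ∑ i, w i ≤ ∑ i, a i) ∧
      (J ≠ lexSet a → (∀ u ∈ J, ∃ w ≤ u, w ∈ J ∧ ∑ i, w i < ∑ i, a i) ∧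
        ∀ j : ℕ, (∀ i : Fin n, n ≤ i + j → a i = 0) → ∀ t, ∑ i, a i + n ≤ t + j + 1 →
          coeff t ((1 - X) ^ n * degSeries Jᶜ) = 0) := by
  induction n with
  | zero =>
    have hJu : J = Set.univ := by
      ext u
      obtain ⟨v, hv⟩ := hne
      simpa [Subsingleton.elim u v] using hv
    refine ⟨0, ⟨0, ?_, by simp, by simp⟩, fun u hu => ⟨u, le_rfl, hu, by simp⟩, fun h => ?_⟩
    · simp [hJu, lexSet_of_subsingleton]
    · exact absurd (hJu.trans (lexSet_of_subsingleton _).symm) h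
  | succ n ih =>
    obtain ⟨a, ⟨Q, hQ, hQ0, hQz⟩, hgen, hstrict⟩ := ih (stronglyStable_localize hJ)
      (hne.elim fun u hu => ⟨_, dropLast_mem_localize hu⟩)
    obtain ⟨κ, hκ⟩ := Int.eq_ofNat_of_zero_le
      (Finset.sum_nonneg fun s (_ : s ∈ Finset.range (∑ i, a i)) => hQ0 s)
    have hfin := hJ.gap_finite hgen
    set c := (gap J).ncard with hc
    have hbound : ∀ u ∈ gap J, ∑ i, u i < ∑ i, a i + c := by
      intro u hu
      obtain ⟨w, hwu, hw, hwa⟩ := hgen _ hu.2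
      have := hJ.sum_lt_of_mem_gap hfin hu hwu hw
      omega
    have hlexκ : localize J = lexSet a → κ = 0 := by
      intro h
      have h0 : (1 - X) * Q = 0 := by
        rw [h] at hQ
        simpa using hQ.symm
      have h1 : Q = 0 := (mul_eq_zero.1 h0).resolve_left one_sub_X_ne_zero
      simpa [h1] using hκ.symm
    have hgapS : J ≠ lexSet (appendExp a (c + κ)) →
        ∀ u ∈ gap J, ∑ i, u i + 1 < ∑ i, a i + (c + κ) := by
      intro hneq u hu
      by_cases h : localize J = lexSet a
      · obtain ⟨w, hwu, hw, hwa⟩ := hgen _ hu.2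
        by_contra hlt
        have hκ0 := hlexκ h
        apply hneq
        rw [hκ0, add_zero]
        exact hJ.eq_lexSet hfin h hu hwu (h ▸ hw) hwa (by omega)
      · obtain ⟨w, hwu, hw, hwa⟩ := (hstrict h).1 _ hu.2
        have := hJ.sum_lt_of_mem_gap hfin hu hwu hw
        omega
    have hempty : c + κ = 0 → gap J = ∅ := by
      intro h
      exact (Set.ncard_eq_zero hfin).1 (by omega)
    have heq : c + κ = 0 → localize J = lexSet a → J = lexSet (appendExp a (c + κ)) := by
      intro h h'
      refine eq_of_localize_eq_of_gap_eq (by rw [localize_lexSet, h']) ?_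
      rw [gap_lexSet, hempty h, h]
      simp [column]
    refine ⟨appendExp a (c + κ), hJ.exists_series_eq hgen hQ hQ0 hQz hκ.symm, fun u hu => ?_,
      fun hneq => ⟨fun u hu => ?_, fun j hj t ht => ?_⟩⟩
    · obtain ⟨w, hwu, hw, hmin⟩ := exists_minimal_le hu
      refine ⟨w, hwu, hw, ?_⟩
      rw [sum_appendExp]
      rcases hJ.minimal_cases hw hmin with ⟨x, hx, hwx⟩ | h
      · have := hbound x hx
        omega
      · obtain ⟨v, hvw, hv, hva⟩ := hgen _ (dropLast_mem_localize hw)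
        have := h v hvw hv
        omega
    · obtain ⟨w, hwu, hw, hmin⟩ := exists_minimal_le hu
      refine ⟨w, hwu, hw, ?_⟩
      rw [sum_appendExp]
      rcases hJ.minimal_cases hw hmin with ⟨x, hx, hwx⟩ | h
      · have := hgapS hneq x hx
        omega
      · by_cases h' : localize J = lexSet a
        · obtain ⟨v, hvw, hv, hva⟩ := hgen _ (dropLast_mem_localize hw)
          have := h v hvw hv
          have : c + κ ≠ 0 := fun h0 => hneq (heq h0 h')
          omega
        · obtain ⟨v, hvw, hv, hva⟩ := (hstrict h').1 _ (dropLast_mem_localize hw)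
          have := h v hvw hv
          omega
    · rw [sum_appendExp] at ht
      rw [one_sub_X_pow_mul_degSeries_compl, map_add]
      cases j with
      | zero =>
        have h1 : coeff t ((1 - X) ^ n * degSeries (localize J)ᶜ) = 0 := by
          by_cases h' : localize J = lexSet a
          · rw [h']
            exact coeff_lexSet_eq_zero a t (by omega)
          · exact (hstrict h').2 0 (fun i hi => absurd i.2 (by omega)) t (by omega)
        rw [h1, zero_add]
        rcases Set.eq_empty_or_nonempty (gap J) with h0 | ⟨u, hu⟩
        · simp [h0]
        have := hgapS hneq u hu
        refine coeff_one_sub_X_pow_mul_of_le (N := ∑ i, a i + (c + κ) - 1) (fun s hs => ?_) _ _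
          (by omega)
        refine coeff_degSeries_eq_zero fun v hv => ?_
        have := hgapS hneq v hv
        omega
      | succ j =>
        have h0 : c + κ = 0 := by simpa using hj (Fin.last n) (by simp)
        have h' : localize J ≠ lexSet a := fun h => hneq (heq h0 h)
        rw [hempty h0, degSeries_empty, mul_zero, map_zero, add_zero]
        refine (hstrict h').2 j (fun i hi => ?_) t (by omega)
        simpa using hj i.castSucc (by simp; omega)

end Comparison

/-! ### Monomial ideals and their exponent sets -/

section MonomialIdeal

variable {k : Type*} [Field k] {N : ℕ}

/-- The exponents of the monomials in an ideal. -/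
def monomialSet (I : Ideal (MvPolynomial (Fin N) k)) : Set (Fin N → ℕ) :=
  {u | MvPolynomial.monomial (Finsupp.equivFunOnFinite.symm u) (1 : k) ∈ I}

lemma coe_mem_monomialSet {I : Ideal (MvPolynomial (Fin N) k)} {u : Fin N →₀ ℕ} :
    (u : Fin N → ℕ) ∈ monomialSet I ↔ MvPolynomial.monomial u (1 : k) ∈ I := by
  rw [monomialSet, Set.mem_ofPred_eq, Finsupp.equivFunOnFinite_symm_coe]

lemma IsMonomialIdeal.mem_iff {I : Ideal (MvPolynomial (Fin N) k)} (hI : IsMonomialIdeal I)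
    {p : MvPolynomial (Fin N) k} :
    p ∈ I ↔ ∀ x ∈ p.support, MvPolynomial.monomial x (1 : k) ∈ I := by
  classical
  obtain ⟨S, rfl⟩ := hI
  rw [MvPolynomial.mem_ideal_span_monomial_image]
  refine forall₂_congr fun x _ => ?_
  rw [MvPolynomial.mem_ideal_span_monomial_image, MvPolynomial.support_monomial,
    if_neg one_ne_zero]
  simp

lemma IsMonomialIdeal.eq_of_monomialSet_eq {I J : Ideal (MvPolynomial (Fin N) k)}
    (hI : IsMonomialIdeal I) (hJ : IsMonomialIdeal J) (h : monomialSet I = monomialSet J) :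
    I = J := by
  ext p
  rw [hI.mem_iff, hJ.mem_iff]
  refine forall₂_congr fun x _ => ?_
  rw [← coe_mem_monomialSet, ← coe_mem_monomialSet, h]

lemma IsMonomialIdeal.hilbFn_eq {I : Ideal (MvPolynomial (Fin N) k)} (hI : IsMonomialIdeal I)
    (t : ℕ) :
    hilbFn I t = ({u | u ∈ (monomialSet I)ᶜ ∧ ∑ i, u i = t} : Set (Fin N → ℕ)).ncard := by
  set T : Set (Fin N → ℕ) := {u | u ∈ (monomialSet I)ᶜ ∧ ∑ i, u i = t} with hT
  have hTfin : T.Finite := finite_of_sum_le t fun u hu => hu.2.le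
  have : Finite T := hTfin
  have := Fintype.ofFinite T
  let φ : MvPolynomial.homogeneousSubmodule (Fin N) k t →ₗ[k] (T → k) :=
    LinearMap.pi fun u => (MvPolynomial.lcoeff k (Finsupp.equivFunOnFinite.symm u.1)).comp
      (MvPolynomial.homogeneousSubmodule (Fin N) k t).subtype
  have hφ : ∀ p u, φ p u = MvPolynomial.coeff (Finsupp.equivFunOnFinite.symm u.1) p.1 :=
    fun p u => rfl
  have hsurj : LinearMap.range φ = ⊤ := by
    classical
    rw [LinearMap.range_eq_top]
    intro f
    have hmem : ∀ u : T, MvPolynomial.monomial (Finsupp.equivFunOnFinite.symm u.1) (1 : k) ∈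
        MvPolynomial.homogeneousSubmodule (Fin N) k t := fun u =>
      MvPolynomial.isHomogeneous_monomial _ (by rw [Finsupp.degree_eq_sum]; exact u.2.2)
    refine ⟨∑ u : T, f u • ⟨_, hmem u⟩, ?_⟩
    ext v
    rw [map_sum, Finset.sum_apply, Finset.sum_eq_single v]
    · simp [hφ]
    · intro u _ huv
      rw [map_smul, Pi.smul_apply, hφ, MvPolynomial.coeff_monomial, if_neg, smul_zero]
      exact fun h => huv (Subtype.ext (Finsupp.equivFunOnFinite.symm.injective h))
    · simp
  have hker : Submodule.comap (MvPolynomial.homogeneousSubmodule (Fin N) k t).subtype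
      (Submodule.restrictScalars k I) = LinearMap.ker φ := by
    ext ⟨p, hp⟩
    rw [Submodule.mem_comap, Submodule.restrictScalars_mem, LinearMap.mem_ker,
      Submodule.subtype_apply, hI.mem_iff]
    constructor
    · intro h
      ext u
      rw [hφ]
      by_contra hne
      exact u.2.1 (h _ (MvPolynomial.mem_support_iff.2 hne))
    · intro h x hx
      by_contra hxI
      rw [MvPolynomial.mem_support_iff] at hx
      have hdeg : ∑ i, x i = t := by
        rw [← Finsupp.degree_eq_sum, Finsupp.degree_eq_weight_one]
        exact hp hx
      have := congrFun h ⟨x, by rwa [Set.mem_compl_iff, coe_mem_monomialSet], hdeg⟩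
      rw [hφ] at this
      simp only [Finsupp.equivFunOnFinite_symm_coe] at this
      exact hx this
  rw [hilbFn, hker, (φ.quotKerEquivRange).finrank_eq, hsurj, finrank_top,
    Module.finrank_fintype_fun_eq_card, ← Nat.card_eq_fintype_card, Nat.card_coe_set_eq]

lemma IsMonomialIdeal.mk_hilbFn {I : Ideal (MvPolynomial (Fin N) k)} (hI : IsMonomialIdeal I) :
    PowerSeries.mk (fun i => (hilbFn I i : ℤ)) = degSeries (monomialSet I)ᶜ := by
  ext t
  rw [PowerSeries.coeff_mk, coeff_degSeries, hI.hilbFn_eq]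

lemma monomialSet_upper (I : Ideal (MvPolynomial (Fin N) k)) : IsUpperSet (monomialSet I) := by
  intro u v huv hu
  obtain ⟨w, rfl⟩ := exists_add_of_le huv
  have h := I.mul_mem_right (MvPolynomial.monomial (Finsupp.equivFunOnFinite.symm w) (1 : k)) hu
  rw [MvPolynomial.monomial_mul, one_mul] at h
  have hadd : Finsupp.equivFunOnFinite.symm (u + w) =
      Finsupp.equivFunOnFinite.symm u + Finsupp.equivFunOnFinite.symm w :=
    Finsupp.ext fun _ => rfl
  rwa [monomialSet, Set.mem_ofPred_eq, hadd]

lemma IsBorel.stronglyStable {I : Ideal (MvPolynomial (Fin N) k)} (hI : IsBorel I) :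
    StronglyStable (monomialSet I) where
  upper := monomialSet_upper I
  borel := by
    intro u i j hij hu
    have h := hI _ hu j (by simp) i hij
    have heq : Finsupp.equivFunOnFinite.symm (u + Pi.single i 1) =
        Finsupp.equivFunOnFinite.symm (u + Pi.single j 1) - Finsupp.single j 1 +
          Finsupp.single i 1 := by
      ext l
      rw [Finsupp.add_apply, Finsupp.tsub_apply, Finsupp.single_eq_pi_single,
        Finsupp.single_eq_pi_single]
      simp
    rwa [monomialSet, Set.mem_ofPred_eq, heq]

lemma gap_monomialSet_eq_empty {I : Ideal (MvPolynomial (Fin (N + 1)) k)} (hmon : IsMonomialIdeal I)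
    (hI : IsBorel I) (hsat : IsSaturatedIdeal I) : gap (monomialSet I) = ∅ := by
  classical
  rw [Set.eq_empty_iff_forall_notMem]
  rintro u ⟨hu, b, hb⟩
  apply hu
  have hJ := hI.stronglyStable
  refine hsat _ ⟨b + 1, by omega, fun g hg => ?_⟩
  have hg' := (MvPolynomial.mem_pow_idealOfVars_iff (b + 1) g).1 hg
  rw [hmon.mem_iff]
  intro x hx
  obtain ⟨y, hy, rfl⟩ : ∃ y ∈ g.support, Finsupp.equivFunOnFinite.symm u + y = x := by
    rw [MvPolynomial.mem_support_iff, MvPolynomial.coeff_monomial_mul'] at hx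
    split_ifs at hx with hle
    · exact ⟨_, MvPolynomial.mem_support_iff.2 (by simpa using hx), add_tsub_cancel_of_le hle⟩
    · exact absurd rfl hx
  have hdeg := hg' y hy
  rw [Finsupp.degree_eq_sum] at hdeg
  rw [← coe_mem_monomialSet]
  have hsum : ∑ i, dropLast (y : Fin (N + 1) → ℕ) i + y (Fin.last N) = ∑ i, y i := by
    simp [Fin.sum_univ_castSucc]
  have h1 := hJ.appendExp_add_mem (dropLast (y : Fin (N + 1) → ℕ)) (dropLast u) (y (Fin.last N))
    (hJ.upper (appendExp_le.2 ⟨le_rfl, by omega⟩) hb)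
  refine hJ.upper ?_ h1
  intro i
  refine Fin.lastCases ?_ (fun i => ?_) i <;> simp

lemma isMonomialIdeal_lexIdealGen (n : ℕ) (a : ℕ → ℕ) : IsMonomialIdeal (lexIdealGen k n a) :=
  ⟨lexExp n a '' {m | m < n}, by rw [lexIdealGen, Set.image_image]⟩

lemma lexExp_apply (n : ℕ) (a : ℕ → ℕ) (m : ℕ) (t : Fin (n + 1)) : lexExp n a m t =
    if (t : ℕ) < m then a (n - 1 - (t : ℕ))
    else if (t : ℕ) = m then (if m = n - 1 then a 0 else a (n - 1 - m) + 1)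
    else 0 := rfl

lemma monomialSet_lexIdealGen (n : ℕ) (hn : 0 < n) (a : ℕ → ℕ) :
    monomialSet (lexIdealGen k n a) =
      {u | dropLast u ∈ lexSet fun i : Fin n => a (n - 1 - i)} := by
  classical
  have hmem : ∀ u : Fin (n + 1) → ℕ, u ∈ monomialSet (lexIdealGen k n a) ↔
      ∃ m < n, ∀ t : Fin n, lexExp n a m t.castSucc ≤ u t.castSucc := by
    intro u
    rw [monomialSet, Set.mem_ofPred_eq, lexIdealGen,
      ← Set.image_image (fun s => MvPolynomial.monomial s (1 : k)) (lexExp n a),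
      MvPolynomial.mem_ideal_span_monomial_image, MvPolynomial.support_monomial,
      if_neg one_ne_zero]
    simp only [Finset.mem_singleton, forall_eq, Set.exists_mem_image, Set.mem_ofPred_eq]
    refine exists_congr fun m => and_congr_right fun hm => ⟨fun h t => h t.castSucc, fun h t => ?_⟩
    refine Fin.lastCases ?_ (fun t => ?_) t
    · rw [lexExp_apply, if_neg (by simp; omega), if_neg (by simp; omega)]
      exact Nat.zero_le _
    · exact h t
  ext u
  rw [hmem, Set.mem_ofPred_eq]
  constructor
  · rintro ⟨m, hm, h⟩
    refine lexSet_upper _ (show (fun t : Fin n => lexExp n a m t.castSucc) ≤ dropLast u from h) ?_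
    by_cases hmn : m = n - 1
    · refine Or.inl (funext fun t => ?_)
      have := t.2
      rw [lexExp_apply, Fin.val_castSucc]
      split_ifs with h1 h2
      · rfl
      · rw [h2, hmn, Nat.sub_self]
      · omega
    · refine Or.inr ⟨⟨m, hm⟩, fun j hj => ?_, ?_⟩
      · change a (n - 1 - j) = lexExp n a m j.castSucc
        rw [lexExp_apply, if_pos (by simpa [Fin.lt_def] using hj), Fin.val_castSucc]
      · simp [lexExp_apply, hmn]
  · rintro (h | ⟨i, hi, hi'⟩)
    · refine ⟨n - 1, by omega, fun t => ?_⟩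
      have ht : u t.castSucc = a (n - 1 - t) := congrFun h t
      have := t.2
      rw [lexExp_apply, ht, Fin.val_castSucc, if_pos rfl]
      split_ifs with h1 h2
      · exact le_rfl
      · rw [h2, Nat.sub_self]
      · exact Nat.zero_le _
    · refine ⟨i, i.2, fun t => ?_⟩
      rw [lexExp_apply, Fin.val_castSucc]
      split_ifs with h1 h2 h3
      · exact (hi t h1).le
      · have : t = i := Fin.ext h2
        subst this
        change a (n - 1 - t) < dropLast u t at hi'
        rw [h3, Nat.sub_self] at hi'
        exact hi'.le
      · have : t = i := Fin.ext h2
        subst this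
        exact hi'
      · exact Nat.zero_le _

end MonomialIdeal

/-! ### The Hilbert polynomial of a lexicographic ideal -/

section HilbertPolynomial

open PowerSeries

lemma polyBinom_eval (a : ℤ) (b t s : ℕ) (h : (s : ℤ) = t + a) :
    (polyBinom a (b : ℤ)).eval (t : ℚ) = (s.choose b : ℚ) := by
  have h' : (t : ℚ) + a = (s : ℚ) := by exact_mod_cast h.symm
  rw [polyBinom, if_pos (Int.natCast_nonneg b), Int.toNat_natCast, Polynomial.eval_smul,
    Polynomial.eval_comp, Polynomial.eval_add, Polynomial.eval_X, Polynomial.eval_C, h',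
    descPochhammer_eval_eq_descFactorial, smul_eq_mul, Nat.descFactorial_eq_factorial_mul_choose,
    Nat.cast_mul, inv_mul_cancel_left₀]
  exact_mod_cast b.factorial_ne_zero

/-- The exponent vector with successive differences of `e` as entries, in reverse order. -/
def diffExp (n : ℕ) (e : ℕ → ℕ) : Fin n → ℕ := fun i => e (n - 1 - i) - e (n - 1 - i + 1)

lemma diffExp_succ (n : ℕ) (e : ℕ → ℕ) :
    diffExp (n + 1) e = appendExp (diffExp n fun j => e (j + 1)) (e 0 - e 1) := by
  ext i
  refine Fin.lastCases ?_ (fun i => ?_) i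
  · simp [diffExp]
  · have := i.2
    rw [appendExp_castSucc, diffExp, diffExp, Fin.val_castSucc,
      show n + 1 - 1 - (i : ℕ) = n - 1 - i + 1 by omega]

lemma sum_diffExp (n : ℕ) : ∀ e : ℕ → ℕ, Antitone e → e n = 0 → ∑ i, diffExp n e i = e 0 := by
  induction n with
  | zero => intro e _ h; simp [h]
  | succ n ih =>
    intro e he h
    rw [diffExp_succ, sum_appendExp, ih (fun j => e (j + 1)) (fun i j hij => he (by omega)) h]
    have := he (zero_le_one' ℕ)
    simp only [zero_add]
    omega

lemma degSeries_lexSet_diffExp (n : ℕ) : ∀ e : ℕ → ℕ, Antitone e → e n = 0 →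
    degSeries (lexSet (diffExp n e))ᶜ =
      ∑ j ∈ Finset.range n, (X ^ e (j + 1) - X ^ e j) * (mk 1 : PowerSeries ℤ) ^ (j + 1) := by
  induction n with
  | zero => intro e _ _; simp [lexSet_of_subsingleton]
  | succ n ih =>
    intro e he h
    have he' : Antitone fun j => e (j + 1) := fun i j hij => he (by omega)
    have h01 := he (zero_le_one' ℕ)
    have key := one_sub_X_mul_degSeries_compl (lexSet (diffExp (n + 1) e))
    rw [diffExp_succ, localize_lexSet, gap_lexSet, ih (fun j => e (j + 1)) he' h,
      one_sub_X_mul_degSeries_column,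
      sum_diffExp n (fun j => e (j + 1)) he' h,
      show e (0 + 1) + (e 0 - e 1) = e 0 by simp only [zero_add]; omega]
      at key
    have hV := mk_one_mul_one_sub_eq_one ℤ
    rw [Finset.sum_range_succ', diffExp_succ]
    have hsum : ∑ j ∈ Finset.range n, (X ^ e (j + 1 + 1) - X ^ e (j + 1)) *
        (mk 1 : PowerSeries ℤ) ^ (j + 1 + 1) = mk 1 * ∑ j ∈ Finset.range n,
          (X ^ e (j + 1 + 1) - X ^ e (j + 1)) * (mk 1 : PowerSeries ℤ) ^ (j + 1) := by
      rw [Finset.mul_sum]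
      exact Finset.sum_congr rfl fun j _ => by ring
    rw [hsum]
    linear_combination (mk 1 : PowerSeries ℤ) * key -
      degSeries (lexSet (appendExp (diffExp n fun j => e (j + 1)) (e 0 - e 1)))ᶜ * hV

lemma sum_telescope (e : ℕ → ℕ) (n : ℕ) :
    ∑ j ∈ Finset.range n, (X ^ e (j + 1) - X ^ e j) * (mk 1 : PowerSeries ℤ) ^ (j + 2) =
      ∑ j ∈ Finset.range n, (1 - X ^ e j) * (X * (mk 1 : PowerSeries ℤ) ^ (j + 2)) +
        (1 - X ^ e 0) * mk 1 - (1 - X ^ e n) * mk 1 ^ (n + 1) := by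
  induction n with
  | zero => simp
  | succ n ih =>
    have hV := mk_one_mul_one_sub_eq_one ℤ
    rw [Finset.sum_range_succ, Finset.sum_range_succ, ih]
    linear_combination ((1 - X ^ e n) * (mk 1 : PowerSeries ℤ) ^ (n + 1)) * hV

lemma coeff_X_mul_mk_one_pow (j t : ℕ) :
    coeff t (X * (mk 1 : PowerSeries ℤ) ^ (j + 2)) = ((t + j).choose (j + 1) : ℤ) := by
  cases t with
  | zero => simp
  | succ t =>
    rw [coeff_succ_X_mul, mk_one_pow_eq_mk_choose_add, coeff_mk]
    congr 2
    omega

lemma coeff_one_sub_X_pow_mul (e t : ℕ) (h : e ≤ t) (A : PowerSeries ℤ) :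
    coeff t ((1 - X ^ e) * A) = coeff t A - coeff (t - e) A := by
  obtain ⟨s, rfl⟩ := exists_add_of_le h
  rw [sub_mul, one_mul, map_sub, add_comm e s, coeff_X_pow_mul, Nat.add_sub_cancel]

lemma coeff_degSeries_cylinder_lexSet (n : ℕ) (e : ℕ → ℕ) (he : Antitone e) (hn : e n = 0)
    (t : ℕ) (ht : e 0 ≤ t) :
    coeff t (degSeries {u | dropLast u ∈ (lexSet (diffExp n e))ᶜ}) =
      ∑ j ∈ Finset.range n,
        (((t + j).choose (j + 1) : ℤ) - ((t - e j + j).choose (j + 1) : ℤ)) := by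
  have h1 : degSeries {u | dropLast u ∈ (lexSet (diffExp n e))ᶜ} =
      mk 1 * degSeries (lexSet (diffExp n e))ᶜ := by
    rw [← one_sub_X_mul_degSeries_cylinder (lexSet (diffExp n e))ᶜ, ← mul_assoc,
      mk_one_mul_one_sub_eq_one, one_mul]
  have h2 : mk 1 * degSeries (lexSet (diffExp n e))ᶜ =
      ∑ j ∈ Finset.range n, (X ^ e (j + 1) - X ^ e j) * (mk 1 : PowerSeries ℤ) ^ (j + 2) := by
    rw [degSeries_lexSet_diffExp n e he hn, Finset.mul_sum]
    exact Finset.sum_congr rfl fun j _ => by ring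
  rw [h1, h2, sum_telescope, hn, pow_zero, sub_self, zero_mul, sub_zero, map_add, map_sum,
    coeff_one_sub_X_pow_mul _ _ ht, coeff_mk, coeff_mk, Pi.one_apply, Pi.one_apply, sub_self,
    add_zero]
  refine Finset.sum_congr rfl fun j _ => ?_
  rw [coeff_one_sub_X_pow_mul _ _ ((he (Nat.zero_le j)).trans ht), coeff_X_mul_mk_one_pow,
    coeff_X_mul_mk_one_pow]

lemma mhSum_eval (n d : ℕ) (hdn : d < n) (e : Fin (d + 1) → ℤ) (e' : ℕ → ℕ)
    (he' : ∀ j, (e' j : ℤ) = eExt d e j) (hanti : Antitone e') (t : ℕ) (ht : e' 0 ≤ t) :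
    (mhSum d e).eval (t : ℚ) =
      ((coeff t (degSeries {u | dropLast u ∈ (lexSet (diffExp n e'))ᶜ}) : ℤ) : ℚ) := by
  have hz : ∀ j, d < j → e' j = 0 := by
    intro j hj
    have := he' j
    rw [eExt, dif_neg (by omega)] at this
    exact_mod_cast this
  rw [coeff_degSeries_cylinder_lexSet n e' hanti (hz n hdn) t ht, mhSum,
    Polynomial.eval_finsetSum, ← Finset.sum_subset (Finset.range_mono hdn),
    ← Fin.sum_univ_eq_sum_range
      (fun j => ((t + j).choose (j + 1) : ℤ) - ((t - e' j + j).choose (j + 1) : ℤ)) (d + 1)]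
  · rw [Int.cast_sum]
    refine Finset.sum_congr rfl fun i _ => ?_
    have hi : (e' i : ℤ) = e i := by
      rw [he', eExt, dif_pos (Nat.lt_succ_iff.1 i.2)]
    have hle : e' i ≤ t := (hanti (Nat.zero_le _)).trans ht
    rw [Polynomial.eval_sub]
    have c1 := polyBinom_eval ((i : ℕ) : ℤ) (i + 1) t (t + i) (by push_cast; ring)
    have c2 := polyBinom_eval (((i : ℕ) : ℤ) - e i) (i + 1) t (t - e' i + i)
      (by push_cast [hle]; rw [hi]; ring)
    push_cast at c1 c2 ⊢
    rw [c1, c2]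
  · intro j _ hj
    rw [Finset.mem_range, not_lt] at hj
    rw [hz j (by omega), Nat.sub_zero, sub_self]

lemma exists_polynomial_of_coeff_eq_zero {A : PowerSeries ℤ} {N : ℕ}
    (h : ∀ t, N ≤ t → coeff t A = 0) : ∃ P : Polynomial ℤ, (P : PowerSeries ℤ) = A := by
  refine ⟨trunc N A, ?_⟩
  ext t
  rw [Polynomial.coeff_coe, coeff_trunc]
  split_ifs with ht
  · rfl
  · exact (h t (by omega)).symm

lemma one_sub_X_pow_mul_degSeries_univ (n : ℕ) :
    (1 - X) ^ n * degSeries (Set.univ : Set (Fin n → ℕ)) = 1 := by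
  induction n with
  | zero =>
    ext t
    rw [pow_zero, one_mul, coeff_degSeries, coeff_one]
    split_ifs with h
    · subst h
      simp [Set.ncard_univ]
    · have : {u : Fin 0 → ℕ | u ∈ Set.univ ∧ ∑ i, u i = t} = ∅ := by
        ext u
        simpa using fun h' => h h'.symm
      rw [this, Set.ncard_empty, Nat.cast_zero]
  | succ n ih =>
    have h : (1 - X) * degSeries (Set.univ : Set (Fin (n + 1) → ℕ)) = degSeries Set.univ :=
      one_sub_X_mul_degSeries_cylinder (Set.univ : Set (Fin n → ℕ))
    rw [pow_succ, mul_assoc, h, ih]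

lemma one_sub_X_pow_mul_degSeries_lexSet {n : ℕ} (a : Fin n → ℕ) :
    ∃ P : Polynomial ℤ, (1 - X) ^ n * degSeries (lexSet a)ᶜ = (1 - X) * (P : PowerSeries ℤ) := by
  induction n with
  | zero => exact ⟨0, by simp [lexSet_of_subsingleton]⟩
  | succ n ih =>
    obtain ⟨a, c, rfl⟩ := exists_eq_appendExp a
    obtain ⟨P, hP⟩ := ih a
    refine ⟨P + (1 - Polynomial.X) ^ n *
      ∑ i ∈ Finset.range c, Polynomial.X ^ (∑ j, a j + i), ?_⟩
    rw [one_sub_X_pow_mul_degSeries_compl, localize_lexSet, gap_lexSet, hP]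
    push_cast [coe_sum_X_pow_eq_degSeries_column]
    ring

end HilbertPolynomial

/-- If `I` is a saturated Borel monomial ideal with Hilbert polynomial `p` of degree
`d < n` (Macaulay–Hartshorne partition `e_0 ≥ … ≥ e_d > 0`) and `I` is not the
lexicographic ideal `L^p_n`, then `deg hk_{L^p_n} > deg hk_I`, where `hk_J` denotes the
K-polynomial: the numerator of the Hilbert series of `k[x_0,…,x_n]/J`. -/
theorem statement_15 (k : Type*) [Field k] (n d : ℕ) (hdn : d < n)
    (I : Ideal (MvPolynomial (Fin (n + 1)) k))
    (hmon : IsMonomialIdeal I) (hborel : IsBorel I) (hsat : IsSaturatedIdeal I)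
    (e : Fin (d + 1) → ℤ) (he : Antitone e) (hepos : ∀ i, 0 < e i)
    (hp : ∃ N : ℕ, ∀ i : ℕ, N ≤ i → (hilbFn I i : ℚ) = (mhSum d e).eval (i : ℚ))
    (hne : I ≠ lexIdealGen k n (aSeq d e))
    (hkI hkL : Polynomial ℤ)
    (hhkI : (hkI : PowerSeries ℤ) = (1 - PowerSeries.X) ^ (n + 1) *
      PowerSeries.mk (fun i => (hilbFn I i : ℤ)))
    (hhkL : (hkL : PowerSeries ℤ) = (1 - PowerSeries.X) ^ (n + 1) *
      PowerSeries.mk (fun i => (hilbFn (lexIdealGen k n (aSeq d e)) i : ℤ))) :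
    hkI.degree < hkL.degree := by
  obtain ⟨e', he'⟩ : ∃ e' : ℕ → ℕ, ∀ j, (e' j : ℤ) = eExt d e j := by
    refine ⟨fun j => (eExt d e j).toNat, fun j => Int.toNat_of_nonneg ?_⟩
    rw [eExt]
    split_ifs with h
    · exact (hepos _).le
    · exact le_rfl
  have hanti : Antitone e' := by
    intro i j hij
    have h : eExt d e j ≤ eExt d e i := by
      rw [eExt, eExt]
      split_ifs with h1 h2 h2
      · exact he hij
      · omega
      · exact (hepos _).le
      · exact le_rfl
    rw [← he', ← he'] at h
    exact_mod_cast h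
  have hen : e' n = 0 := by
    have := he' n
    rw [eExt, dif_neg (by omega)] at this
    exact_mod_cast this
  have he0 : 0 < e' 0 := by
    have := he' 0
    rw [eExt, dif_pos (Nat.zero_le d)] at this
    have := hepos ⟨0, Nat.succ_pos d⟩
    omega
  have haSeq : (fun i : Fin n => aSeq d e (n - 1 - i)) = diffExp n e' := by
    ext i
    rw [aSeq, ← he', ← he', diffExp]
    omega
  set a := diffExp n e' with ha
  have hsuma : ∑ i, a i = e' 0 := sum_diffExp n e' hanti hen
  have hmonL := isMonomialIdeal_lexIdealGen (k := k) n (aSeq d e)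
  have hsetL := monomialSet_lexIdealGen (k := k) n (by omega) (aSeq d e)
  rw [haSeq] at hsetL
  rw [hmonL.mk_hilbFn, hsetL, pow_succ, mul_assoc,
    show ({u | dropLast u ∈ lexSet a} : Set (Fin (n + 1) → ℕ))ᶜ = {u | dropLast u ∈ (lexSet a)ᶜ}
      from rfl, one_sub_X_mul_degSeries_cylinder] at hhkL
  have hgap := gap_monomialSet_eq_empty hmon hborel hsat
  have hJ := hborel.stronglyStable
  set J := localize (monomialSet I) with hJdef
  have hser := one_sub_X_mul_degSeries_compl (monomialSet I)
  rw [hgap, degSeries_empty, mul_zero, add_zero, ← hJdef] at hser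
  rw [hmon.mk_hilbFn, pow_succ, mul_assoc, hser] at hhkI
  obtain ⟨P, hP⟩ : ∃ P : Polynomial ℤ, (P : PowerSeries ℤ) =
      degSeries (monomialSet I)ᶜ - degSeries {u | dropLast u ∈ (lexSet a)ᶜ} := by
    obtain ⟨N, hN⟩ := hp
    refine exists_polynomial_of_coeff_eq_zero (N := max N (e' 0)) fun t ht => ?_
    have h1 := hN t (by omega)
    rw [mhSum_eval n d hdn e e' he' hanti t (by omega)] at h1
    rw [map_sub, ← hmon.mk_hilbFn, PowerSeries.coeff_mk, sub_eq_zero]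
    exact_mod_cast h1
  have hPJ : degSeries Jᶜ = degSeries (lexSet a)ᶜ + (1 - PowerSeries.X) * (P : PowerSeries ℤ) := by
    rw [hP, mul_sub, hser, one_sub_X_mul_degSeries_cylinder]
    ring
  have hJne : J.Nonempty := by
    rw [Set.nonempty_iff_ne_empty]
    intro h0
    obtain ⟨R, hR⟩ := one_sub_X_pow_mul_degSeries_lexSet a
    have h1 := one_sub_X_pow_mul_degSeries_univ n
    rw [← Set.compl_empty, ← h0, hPJ, mul_add, hR] at h1
    have h2 : (1 - Polynomial.X) * R + (1 - Polynomial.X) ^ n * ((1 - Polynomial.X) * P) = 1 := by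
      rw [← Polynomial.coe_inj (R := ℤ)]
      push_cast
      exact h1
    simpa using congrArg (Polynomial.eval 1) h2
  obtain ⟨b, ⟨Q, hQ, -, hQz⟩, -, hstrict⟩ := (stronglyStable_localize hJ).exists_lexSet hJne
  obtain ⟨Q, rfl⟩ := exists_polynomial_of_coeff_eq_zero (N := ∑ i, b i) (A := Q)
    fun t ht => hQz t (by omega)
  obtain rfl : b = a := by
    refine lexSet_injective_of_series b a (P - Q) ?_
    rw [← hJdef, hPJ] at hQ
    push_cast
    linear_combination -hQ
  have hJlex : J ≠ lexSet a := by
    intro h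
    refine hne (hmon.eq_of_monomialSet_eq hmonL ?_)
    ext u
    rw [hsetL, mem_iff_localize_gap, hgap, ← hJdef, h]
    simp
  obtain ⟨j, hj, hjz, t, ht, hcoef⟩ := exists_coeff_lexSet_ne_zero a (by
    intro h0
    rw [h0] at hsuma
    simp only [Pi.zero_apply, Finset.sum_const_zero] at hsuma
    omega)
  rw [← hhkL, Polynomial.coeff_coe] at hcoef
  refine lt_of_lt_of_le ?_ (Polynomial.le_degree_of_ne_zero hcoef)
  rw [Polynomial.degree_lt_iff_coeff_zero]
  intro s hs
  rw [← Polynomial.coeff_coe, hhkI]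
  exact (hstrict hJlex).2 j hjz s (by omega)
end

section
/- Let k be a field, let I ⊆ k[x_0,…,x_n] be a saturated Borel monomial ideal with Hilbert polynomial p of degree d < n, and let L^p_n be the lexicographic ideal for p. If I ≠ L^p_n, then there exists an integer m such that dim_k (k[x_0,…,x_n]/I)_j = p(j) for all j ≥ m, but dim_k (k[x_0,…,x_n]/L^p_n)_m ≠ p(m). -/
open Finsupp in
/-- A set of monomials in countably many variables `x_0, x_1, …` which is closed under
multiplication and Borel moves, for which the variables `x_j` with `n ≤ j` are nonzerodivisors,
and whose minimal elements have bounded degree. -/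
structure IsBorelSatSet (n : ℕ) (A : Set (ℕ →₀ ℕ)) : Prop where
  up : ∀ u i, u ∈ A → u + single i 1 ∈ A
  borel : ∀ u i j, i < j → u + single j 1 ∈ A → u + single i 1 ∈ A
  sat : ∀ u j, n ≤ j → u + single j 1 ∈ A → u ∈ A
  bounded : ∃ D, ∀ u ∈ A, D < u.degree → ∃ v ∈ A, ∃ i, u = v + single i 1

namespace BorelSet

open Finset Finsupp

/-- Monomials of degree `t` in `x_0, …, x_{N-1}`. -/
noncomputable def mons (N t : ℕ) : Finset (ℕ →₀ ℕ) := (range N).finsuppAntidiag t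

lemma mem_mons {N t : ℕ} {u : ℕ →₀ ℕ} :
    u ∈ mons N t ↔ u.degree = t ∧ ∀ i, N ≤ i → u i = 0 := by
  unfold mons
  rw [Finset.mem_finsuppAntidiag]
  have key : u.support ⊆ range N ↔ ∀ i, N ≤ i → u i = 0 := by
    constructor
    · intro h i hi
      by_contra hne
      have := h (Finsupp.mem_support_iff.2 hne)
      simp at this; omega
    · intro h i hi
      rw [Finsupp.mem_support_iff] at hi
      rw [mem_range]
      by_contra hlt
      exact hi (h i (by omega))
  rw [← key]
  constructor
  · rintro ⟨h1, h2⟩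
    refine ⟨?_, h2⟩
    rw [← h1, Finsupp.degree_apply]
    exact Finset.sum_subset h2 (by intro x _ hx; simpa using hx)
  · rintro ⟨h1, h2⟩
    refine ⟨?_, h2⟩
    rw [← h1, Finsupp.degree_apply]
    exact (Finset.sum_subset h2 (by intro x _ hx; simpa using hx)).symm

open Classical in
/-- Number of monomials of degree `t` in `x_0, …, x_{N-1}` lying outside `A`. -/
noncomputable def hilb (A : Set (ℕ →₀ ℕ)) (N t : ℕ) : ℕ := #{u ∈ mons N t | u ∉ A}

open Classical in
/-- Number of monomials of degree `t` in `x_0, …, x_{N-1}` lying in `B` but not in `A`. -/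
noncomputable def diffCount (A B : Set (ℕ →₀ ℕ)) (N t : ℕ) : ℕ :=
  #{u ∈ mons N t | u ∈ B ∧ u ∉ A}

lemma hilb_eq_add_diffCount {A B : Set (ℕ →₀ ℕ)} (h : A ⊆ B) (N t : ℕ) :
    hilb A N t = hilb B N t + diffCount A B N t := by
  classical
  unfold hilb diffCount
  rw [← Finset.card_union_of_disjoint]
  · congr 1
    ext u
    simp only [mem_filter, mem_union]
    have := @h u
    tauto
  · rw [Finset.disjoint_left]
    simp only [mem_filter]
    tauto

lemma diffCount_pos {A B : Set (ℕ →₀ ℕ)} {N t : ℕ} :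
    0 < diffCount A B N t ↔ ∃ u ∈ mons N t, u ∈ B ∧ u ∉ A := by
  classical
  unfold diffCount
  rw [Finset.card_pos]
  simp [Finset.Nonempty]

lemma add_single_mem_mons {N t i : ℕ} {u : ℕ →₀ ℕ} (hi : i < N) :
    u + single i 1 ∈ mons N (t + 1) ↔ u ∈ mons N t := by
  simp only [mem_mons, map_add, degree_single, Finsupp.add_apply]
  refine and_congr (by omega) (forall₂_congr fun j hj => ?_)
  rw [Finsupp.single_apply, if_neg (by omega)]; simp

lemma eq_sub_add_single {u : ℕ →₀ ℕ} {i : ℕ} (h : u i ≠ 0) :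
    u = (u - single i 1) + single i 1 := by
  ext j
  simp only [Finsupp.add_apply, Finsupp.tsub_apply, Finsupp.single_apply]
  split_ifs with hij
  · subst hij; omega
  · omega

/-- `x_j` is a nonzerodivisor modulo `A` for all `j ≥ N`. -/
def IsCyl (N : ℕ) (A : Set (ℕ →₀ ℕ)) : Prop :=
  ∀ u j, N ≤ j → (u + single j 1 ∈ A ↔ u ∈ A)

lemma _root_.IsBorelSatSet.isCyl {n : ℕ} {A : Set (ℕ →₀ ℕ)} (h : IsBorelSatSet n A) :
    IsCyl n A := fun u j hj => ⟨h.sat u j hj, h.up u j⟩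

lemma hilb_succ_zero (A : Set (ℕ →₀ ℕ)) (N : ℕ) : hilb A (N + 1) 0 = hilb A N 0 := by
  classical
  unfold hilb
  congr 1
  ext u
  simp only [mem_filter, mem_mons, Finsupp.degree_eq_zero_iff]
  constructor
  · rintro ⟨⟨rfl, _⟩, h⟩; exact ⟨⟨rfl, by simp⟩, h⟩
  · rintro ⟨⟨rfl, _⟩, h⟩; exact ⟨⟨rfl, by simp⟩, h⟩

lemma hilb_succ_succ {A : Set (ℕ →₀ ℕ)} {N : ℕ} (h : IsCyl N A) (t : ℕ) :
    hilb A (N + 1) (t + 1) = hilb A (N + 1) t + hilb A N (t + 1) := by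
  classical
  unfold hilb
  have e1 : #{u ∈ mons (N + 1) t | u ∉ A}
      = #(Finset.image (fun u : ℕ →₀ ℕ => u + single N 1) {u ∈ mons (N + 1) t | u ∉ A}) := by
    rw [Finset.card_image_of_injective _ (add_left_injective _)]
  rw [e1, ← Finset.card_union_of_disjoint]
  · congr 1
    ext u
    simp only [mem_filter, mem_union, mem_image]
    constructor
    · rintro ⟨hu, hA⟩
      by_cases h0 : u N = 0
      · right
        refine ⟨?_, hA⟩
        rw [mem_mons] at hu ⊢
        refine ⟨hu.1, fun i hi => ?_⟩
        rcases Nat.eq_or_lt_of_le hi with rfl | hlt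
        · exact h0
        · exact hu.2 i hlt
      · left
        have := eq_sub_add_single h0
        refine ⟨u - single N 1, ⟨?_, ?_⟩, this.symm⟩
        · rw [← add_single_mem_mons (Nat.lt_succ_self N), ← this]; exact hu
        · rw [← h _ N le_rfl, ← this]; exact hA
    · rintro (⟨v, ⟨hv, hA⟩, rfl⟩ | ⟨hu, hA⟩)
      · refine ⟨(add_single_mem_mons (Nat.lt_succ_self N)).2 hv, ?_⟩
        rwa [h _ N le_rfl]
      · refine ⟨?_, hA⟩
        rw [mem_mons] at hu ⊢
        exact ⟨hu.1, fun i hi => hu.2 i (by omega)⟩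
  · rw [Finset.disjoint_left]
    simp only [mem_filter, mem_image]
    rintro u ⟨v, _, rfl⟩ ⟨hu, _⟩
    have := (mem_mons.1 hu).2 N le_rfl
    simp at this

lemma hilb_succ {A : Set (ℕ →₀ ℕ)} {N : ℕ} (h : IsCyl N A) (t : ℕ) :
    hilb A (N + 1) t = ∑ s ∈ range (t + 1), hilb A N s := by
  induction t with
  | zero => simp [hilb_succ_zero]
  | succ t ih => rw [hilb_succ_succ h, Finset.sum_range_succ, ih]

lemma add_mem {A : Set (ℕ →₀ ℕ)} (hup : ∀ u i, u ∈ A → u + single i 1 ∈ A) (u r : ℕ →₀ ℕ)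
    (hu : u ∈ A) : u + r ∈ A := by
  induction hd : r.degree generalizing r with
  | zero => rw [Finsupp.degree_eq_zero_iff] at hd; simpa [hd] using hu
  | succ d ih =>
    have : r ≠ 0 := by rintro rfl; simp at hd
    obtain ⟨i, hi⟩ := Finsupp.ne_iff.1 this
    rw [eq_sub_add_single (by simpa using hi : r i ≠ 0)] at hd ⊢
    rw [← add_assoc]
    apply hup
    apply ih
    simpa using hd

/-- Truncation of a monomial to the first `N` variables. -/
noncomputable def trunc (N : ℕ) (u : ℕ →₀ ℕ) : ℕ →₀ ℕ := u.filter (· < N)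

lemma trunc_apply (N : ℕ) (u : ℕ →₀ ℕ) (i : ℕ) :
    trunc N u i = if i < N then u i else 0 := by
  simp [trunc, Finsupp.filter_apply]

lemma IsCyl.add_mem_iff {N : ℕ} {A : Set (ℕ →₀ ℕ)} (h : IsCyl N A) (u r : ℕ →₀ ℕ)
    (hr : ∀ i < N, r i = 0) : u + r ∈ A ↔ u ∈ A := by
  induction hd : r.degree generalizing r with
  | zero => rw [Finsupp.degree_eq_zero_iff] at hd; simp [hd]
  | succ d ih =>
    have : r ≠ 0 := by rintro rfl; simp at hd
    obtain ⟨i, hi⟩ := Finsupp.ne_iff.1 this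
    have hi' : r i ≠ 0 := by simpa using hi
    have hiN : N ≤ i := by
      by_contra hlt
      exact hi' (hr i (by omega))
    rw [eq_sub_add_single hi'] at hd ⊢
    rw [← add_assoc, h _ _ hiN]
    apply ih
    · intro j hj; simp [hr j hj]
    · simpa using hd

lemma IsCyl.trunc_mem_iff {N : ℕ} {A : Set (ℕ →₀ ℕ)} (h : IsCyl N A) (u : ℕ →₀ ℕ) :
    trunc N u ∈ A ↔ u ∈ A := by
  have hle : trunc N u ≤ u := by
    intro i; rw [trunc_apply]; split_ifs <;> simp
  conv_rhs => rw [← add_tsub_cancel_of_le hle]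
  rw [h.add_mem_iff]
  intro i hi
  simp [trunc_apply, hi]

lemma trunc_mem_mons (N : ℕ) (u : ℕ →₀ ℕ) : trunc N u ∈ mons N (trunc N u).degree := by
  rw [mem_mons]
  refine ⟨rfl, fun i hi => ?_⟩
  rw [trunc_apply, if_neg (by omega)]

/-- Nested saturated sets with the same eventual Hilbert function agree. -/
lemma eq_of_subset_of_hilb_eq {A B : Set (ℕ →₀ ℕ)} {n : ℕ} (hA : IsCyl n A) (hB : IsCyl n B)
    (hAB : A ⊆ B) (h : ∃ T, ∀ t ≥ T, hilb A (n + 1) t = hilb B (n + 1) t) : A = B := by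
  obtain ⟨T, hT⟩ := h
  refine Set.Subset.antisymm hAB fun u hu => ?_
  by_contra huA
  set w := trunc n u + single n T with hw
  have hr : ∀ i < n, (single n T : ℕ →₀ ℕ) i = 0 := fun i hi => by
    rw [Finsupp.single_apply, if_neg (by omega)]
  have hwB : w ∈ B := by
    rw [hw, hB.add_mem_iff _ _ hr, hB.trunc_mem_iff]; exact hu
  have hwA : w ∉ A := by
    rw [hw, hA.add_mem_iff _ _ hr, hA.trunc_mem_iff]; exact huA
  have hmem : w ∈ mons (n + 1) w.degree := by
    rw [mem_mons]
    refine ⟨rfl, fun i hi => ?_⟩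
    simp only [hw, Finsupp.add_apply, trunc_apply, Finsupp.single_apply]
    rw [if_neg (by omega), if_neg (by omega), add_zero]
  have hdeg : T ≤ w.degree := by simp [hw]
  have h1 := hilb_eq_add_diffCount hAB (n + 1) w.degree
  have h2 : 0 < diffCount A B (n + 1) w.degree := diffCount_pos.2 ⟨w, hmem, hwB, hwA⟩
  have := hT _ hdeg
  omega

/-- Setting `x_n = 1`. -/
def colon (n : ℕ) (A : Set (ℕ →₀ ℕ)) : Set (ℕ →₀ ℕ) := {u | ∃ b, u + single n b ∈ A}

lemma subset_colon (n : ℕ) (A : Set (ℕ →₀ ℕ)) : A ⊆ colon n A := fun u hu => ⟨0, by simpa⟩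

/-- In degrees at least a bound `D` for the degrees of minimal generators, setting `x_n = 1`
changes nothing. -/
lemma mem_of_mem_colon {n D : ℕ} {A : Set (ℕ →₀ ℕ)} (h : IsBorelSatSet (n + 1) A)
    (hD : ∀ u ∈ A, D < u.degree → ∃ v ∈ A, ∃ i, u = v + single i 1) {u : ℕ →₀ ℕ}
    (hu : u ∈ colon n A) (hsupp : ∀ i, n < i → u i = 0) (hdeg : D ≤ u.degree) : u ∈ A := by
  classical
  have hex : ∃ b, u + single n b ∈ A := hu
  have hmin := fun b => Nat.find_min hex (m := b)
  have hspec := Nat.find_spec hex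
  rcases hb : Nat.find hex with _ | b
  · rw [hb] at hspec; simpa using hspec
  exfalso
  rw [hb] at hspec hmin
  have hb' := hmin b (Nat.lt_succ_self b)
  obtain ⟨v, hv, i, hvi⟩ := hD _ hspec (by simp; omega)
  have hsplit : (single n (b + 1) : ℕ →₀ ℕ) = single n b + single n 1 := by
    rw [← Finsupp.single_add]
  rcases lt_trichotomy i n with hin | rfl | hin
  · have hvn : v n ≠ 0 := by
      have := DFunLike.congr_fun hvi n
      simp [hin.ne] at this
      omega
    have h1 := eq_sub_add_single hvn
    rw [h1] at hv
    have h2 := h.borel _ i n hin hv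
    apply hb'
    have h3 : u + single n b = v - single n 1 + single i 1 := by
      apply add_right_cancel (b := (single n 1 : ℕ →₀ ℕ))
      rw [add_assoc, ← hsplit, hvi, add_right_comm, ← h1]
    rwa [h3]
  · apply hb'
    rw [hsplit, ← add_assoc] at hvi
    rwa [add_right_cancel hvi]
  · have := DFunLike.congr_fun hvi i
    simp [hin.ne, hsupp i hin] at this

lemma colon_isBorelSatSet {n : ℕ} {A : Set (ℕ →₀ ℕ)} (h : IsBorelSatSet (n + 1) A) :
    IsBorelSatSet n (colon n A) where
  up := by
    rintro u i ⟨b, hb⟩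
    exact ⟨b, by rw [add_right_comm]; exact h.up _ _ hb⟩
  borel := by
    rintro u i j hij ⟨b, hb⟩
    refine ⟨b, ?_⟩
    rw [add_right_comm] at hb ⊢
    exact h.borel _ i j hij hb
  sat := by
    rintro u j hj ⟨b, hb⟩
    rcases Nat.eq_or_lt_of_le hj with rfl | hlt
    · exact ⟨1 + b, by rw [Finsupp.single_add, ← add_assoc]; exact hb⟩
    · rw [add_right_comm] at hb
      exact ⟨b, h.sat _ j hlt hb⟩
  bounded := by
    obtain ⟨D, hD⟩ := h.bounded
    refine ⟨D, fun u hu hdeg => ?_⟩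
    by_cases hs : ∀ i, n < i → u i = 0
    · obtain ⟨v, hv, i, hi⟩ := hD u (mem_of_mem_colon h hD hu hs hdeg.le) hdeg
      exact ⟨v, subset_colon _ _ hv, i, hi⟩
    · push Not at hs
      obtain ⟨i, hi, hui⟩ := hs
      have h1 := eq_sub_add_single hui
      refine ⟨u - single i 1, ?_, i, h1⟩
      obtain ⟨b, hb⟩ := hu
      refine ⟨b, ?_⟩
      rw [h1, add_right_comm] at hb
      exact h.sat _ i hi hb

/-- The exponent vector `(a_{n-1}, …, a_0)`, where `a_j = e_j - e_{j+1}`. -/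
noncomputable def corner : ℕ → (ℕ → ℕ) → ℕ →₀ ℕ
  | 0, _ => 0
  | n + 1, e => corner n (fun i => e (i + 1)) + single n (e 0 - e 1)

lemma corner_apply (n : ℕ) (e : ℕ → ℕ) (i : ℕ) :
    corner n e i = if i < n then e (n - 1 - i) - e (n - i) else 0 := by
  induction n generalizing e with
  | zero => simp [corner]
  | succ n ih =>
    simp only [corner, Finsupp.add_apply, ih, Finsupp.single_apply]
    rcases lt_trichotomy i n with h | rfl | h
    · rw [if_pos h, if_neg (by omega), if_pos (by omega), add_zero]
      congr 2 <;> omega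
    · simp
    · rw [if_neg (by omega), if_neg (by omega), if_neg (by omega), add_zero]

lemma corner_of_le {n i : ℕ} (e : ℕ → ℕ) (h : n ≤ i) : corner n e i = 0 := by
  rw [corner_apply, if_neg (by omega)]

lemma degree_corner (n : ℕ) {e : ℕ → ℕ} (he : Antitone e) :
    (corner n e).degree = e 0 - e n := by
  induction n generalizing e with
  | zero => simp [corner]
  | succ n ih =>
    have he' : Antitone (fun i => e (i + 1)) := fun i j h => he (by omega)
    simp only [corner, map_add, degree_single, ih he', zero_add]
    have h1 := he (show 1 ≤ n + 1 by omega)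
    have h2 := he (show 0 ≤ 1 by omega)
    omega

/-- The monomials that are lexicographically at least `corner n e`, up to the variables `x_j` with
`j ≥ n`. -/
def lexSet (n : ℕ) (e : ℕ → ℕ) : Set (ℕ →₀ ℕ) :=
  {u | ∀ m < n, (∀ i < m, u i = corner n e i) → corner n e m ≤ u m}

lemma lexSet_zero (e : ℕ → ℕ) : lexSet 0 e = Set.univ := by
  ext u; simp [lexSet]

lemma corner_mem_lexSet (n : ℕ) (e : ℕ → ℕ) : corner n e ∈ lexSet n e := fun _ _ _ => le_rfl

lemma lexSet_isCyl (n : ℕ) (e : ℕ → ℕ) : IsCyl n (lexSet n e) := by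
  intro u j hj
  have key : ∀ i < n, (u + single j 1 : ℕ →₀ ℕ) i = u i := fun i hi => by
    rw [Finsupp.add_apply, Finsupp.single_apply, if_neg (by omega), add_zero]
  refine forall₂_congr fun m hm => ?_
  rw [key m hm]
  refine imp_congr_left (forall₂_congr fun i hi => ?_)
  rw [key i (by omega)]

lemma corner_succ_of_lt {n i : ℕ} (e : ℕ → ℕ) (h : i < n) :
    corner (n + 1) e i = corner n (fun i => e (i + 1)) i := by
  rw [corner, Finsupp.add_apply, Finsupp.single_apply, if_neg (by omega), add_zero]

lemma corner_succ_self (n : ℕ) (e : ℕ → ℕ) : corner (n + 1) e n = e 0 - e 1 := by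
  rw [corner_apply]; simp

lemma mem_lexSet_succ {n : ℕ} {e : ℕ → ℕ} {u : ℕ →₀ ℕ} :
    u ∈ lexSet (n + 1) e ↔ u ∈ lexSet n (fun i => e (i + 1)) ∧
      ((∀ i < n, u i = corner n (fun i => e (i + 1)) i) → e 0 - e 1 ≤ u n) := by
  have hpre : ∀ m ≤ n, (∀ i < m, u i = corner (n + 1) e i) ↔
      ∀ i < m, u i = corner n (fun i => e (i + 1)) i := fun m hm =>
    forall₂_congr fun i hi => by rw [corner_succ_of_lt e (by omega)]
  constructor
  · intro h
    refine ⟨fun m hm hp => ?_, fun hp => ?_⟩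
    · rw [← corner_succ_of_lt e hm]
      exact h m (by omega) ((hpre m hm.le).2 hp)
    · rw [← corner_succ_self n e]
      exact h n (by omega) ((hpre n le_rfl).2 hp)
  · rintro ⟨h1, h2⟩ m hm hp
    rcases Nat.lt_succ_iff_lt_or_eq.1 hm with h | rfl
    · rw [corner_succ_of_lt e h]
      exact h1 m h ((hpre m h.le).1 hp)
    · rw [corner_succ_self]
      exact h2 ((hpre m le_rfl).1 hp)

lemma lexSet_succ_subset (n : ℕ) (e : ℕ → ℕ) :
    lexSet (n + 1) e ⊆ lexSet n (fun i => e (i + 1)) := fun _ hu => (mem_lexSet_succ.1 hu).1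

lemma eq_corner_add_of_mem_mons {n s : ℕ} {e : ℕ → ℕ} {u : ℕ →₀ ℕ} (hu : u ∈ mons (n + 1) s)
    (h : ∀ i < n, u i = corner n e i) : u = corner n e + single n (u n) := by
  ext i
  rw [Finsupp.add_apply, Finsupp.single_apply]
  rcases lt_trichotomy i n with hi | rfl | hi
  · rw [h i hi, if_neg (by omega), add_zero]
  · rw [corner_of_le _ le_rfl, if_pos rfl, zero_add]
  · rw [(mem_mons.1 hu).2 i hi, corner_of_le _ hi.le, if_neg (by omega), add_zero]

lemma diffCount_lexSet_succ (n : ℕ) {e : ℕ → ℕ} (he : Antitone e) (h0 : e (n + 1) = 0) (s : ℕ) :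
    diffCount (lexSet (n + 1) e) (lexSet n (fun i => e (i + 1))) (n + 1) s =
      if e 1 ≤ s ∧ s < e 0 then 1 else 0 := by
  classical
  have he' : Antitone (fun i => e (i + 1)) := fun i j h => he (by omega)
  have hdeg : (corner n (fun i => e (i + 1))).degree = e 1 := by
    rw [degree_corner n he']; simp [h0]
  unfold diffCount
  have key : ∀ u, u ∈ mons (n + 1) s ∧ u ∈ lexSet n (fun i => e (i + 1)) ∧ u ∉ lexSet (n + 1) e ↔
      (e 1 ≤ s ∧ s < e 0) ∧ u = corner n (fun i => e (i + 1)) + single n (s - e 1) := by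
    intro u
    constructor
    · rintro ⟨hu, h1, h2⟩
      rw [mem_lexSet_succ] at h2
      push Not at h2
      obtain ⟨h3, h4⟩ := h2 h1
      have h5 := eq_corner_add_of_mem_mons hu h3
      have h6 := (mem_mons.1 hu).1
      rw [h5] at h6
      simp only [map_add, degree_single, hdeg] at h6
      refine ⟨by omega, ?_⟩
      rw [show s - e 1 = u n by omega]
      exact h5
    · rintro ⟨hs, rfl⟩
      refine ⟨mem_mons.2 ⟨?_, fun i hi => ?_⟩, ?_, ?_⟩
      · simp only [map_add, degree_single, hdeg]; omega
      · rw [Finsupp.add_apply, corner_of_le _ (by omega), Finsupp.single_apply,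
          if_neg (by omega), add_zero]
      · rw [(lexSet_isCyl _ _).add_mem_iff]
        · exact corner_mem_lexSet _ _
        · intro i hi; rw [Finsupp.single_apply, if_neg (by omega)]
      · rw [mem_lexSet_succ]
        rintro ⟨-, h⟩
        have := h fun i hi => by
          rw [Finsupp.add_apply, Finsupp.single_apply, if_neg (by omega), add_zero]
        rw [Finsupp.add_apply, corner_of_le _ le_rfl, Finsupp.single_eq_same] at this
        omega
  split_ifs with hs
  · rw [Finset.card_eq_one]
    refine ⟨corner n (fun i => e (i + 1)) + single n (s - e 1), ?_⟩
    ext u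
    rw [mem_filter, key, mem_singleton]
    tauto
  · rw [Finset.card_eq_zero, Finset.filter_eq_empty_iff]
    intro u hu h
    exact hs ((key u).1 ⟨hu, h⟩).1

lemma hilb_lexSet_step (n : ℕ) {e : ℕ → ℕ} (he : Antitone e) (h0 : e (n + 1) = 0) (s : ℕ) :
    hilb (lexSet (n + 1) e) (n + 1) s = hilb (lexSet n (fun i => e (i + 1))) (n + 1) s +
      if e 1 ≤ s ∧ s < e 0 then 1 else 0 := by
  rw [hilb_eq_add_diffCount (lexSet_succ_subset n e), diffCount_lexSet_succ n he h0]

lemma mem_lexSet_of_lt {n m : ℕ} {e : ℕ → ℕ} {v : ℕ →₀ ℕ} (hm : m < n)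
    (hpre : ∀ i < m, v i = corner n e i) (hlt : corner n e m < v m) : v ∈ lexSet n e := by
  intro m' hm' hp
  rcases lt_trichotomy m' m with h | rfl | h
  · exact (hpre m' h).ge
  · exact hlt.le
  · exact absurd (hp m h) hlt.ne'

lemma exists_single_of_degree_eq_one {r : ℕ →₀ ℕ} (h : r.degree = 1) :
    ∃ j, r = single j 1 := by
  have : r ≠ 0 := by rintro rfl; simp at h
  obtain ⟨i, hi⟩ := Finsupp.ne_iff.1 this
  have h1 := eq_sub_add_single (by simpa using hi : r i ≠ 0)
  rw [h1] at h
  simp only [map_add, degree_single] at h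
  have h2 : (r - single i 1).degree = 0 := by omega
  rw [Finsupp.degree_eq_zero_iff] at h2
  exact ⟨i, by rw [h1, h2, zero_add]⟩

/-- A minimal element of the lexicographic set with the same degree as its corner is either the
corner or differs from it by a Borel move. -/
lemma exists_borel_move_corner {n d : ℕ} {e : ℕ → ℕ} {g : ℕ →₀ ℕ} (hg : g ∈ lexSet n e)
    (hgm : g ∈ mons (n + 1) d) (hd : (corner n e).degree = d) (hne : g ≠ corner n e)
    (hmin : ∀ i, g i ≠ 0 → g - single i 1 ∉ lexSet n e) :
    ∃ h m j, m < j ∧ g = h + single m 1 ∧ corner n e = h + single j 1 := by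
  classical
  have hex : ∃ m, g m ≠ corner n e m := by
    simpa using Finsupp.ne_iff.1 hne
  obtain ⟨m, hm, hpre⟩ : ∃ m, g m ≠ corner n e m ∧ ∀ i < m, g i = corner n e i :=
    ⟨Nat.find hex, Nat.find_spec hex, fun i hi => not_not.1 (Nat.find_min hex hi)⟩
  have hmn : m < n := by
    by_contra hmn
    have h1 := eq_corner_add_of_mem_mons hgm (fun i hi => hpre i (by omega))
    have h2 := (mem_mons.1 hgm).1
    rw [h1] at h2
    simp only [map_add, degree_single, hd] at h2
    have h3 : g n = 0 := by omega
    rw [h3, Finsupp.single_zero, add_zero] at h1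
    exact hne h1
  have hlt : corner n e m < g m := lt_of_le_of_ne (hg m hmn hpre) (Ne.symm hm)
  have hzero : ∀ i, m < i → g i = 0 := by
    intro i hi
    by_contra h0
    refine hmin i h0 (mem_lexSet_of_lt hmn (fun t ht => ?_) ?_)
    · rw [Finsupp.tsub_apply, Finsupp.single_apply, if_neg (by omega), hpre t ht, tsub_zero]
    · rw [Finsupp.tsub_apply, Finsupp.single_apply, if_neg (by omega), tsub_zero]
      exact hlt
  have hgm1 : g m = corner n e m + 1 := by
    by_contra h1
    refine hmin m (by omega) (mem_lexSet_of_lt hmn (fun t ht => ?_) ?_)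
    · rw [Finsupp.tsub_apply, Finsupp.single_apply, if_neg (by omega), hpre t ht, tsub_zero]
    · rw [Finsupp.tsub_apply, Finsupp.single_eq_same]
      omega
  have h1 := eq_sub_add_single (u := g) (i := m) (by omega)
  have hle : g - single m 1 ≤ corner n e := by
    intro i
    rw [Finsupp.tsub_apply, Finsupp.single_apply]
    rcases lt_trichotomy i m with hi | rfl | hi
    · rw [hpre i hi]; exact Nat.sub_le _ _
    · rw [if_pos rfl]; omega
    · rw [hzero i hi]; simp
  have h2 := add_tsub_cancel_of_le hle
  have h3 : (corner n e - (g - single m 1)).degree = 1 := by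
    have h4 := (mem_mons.1 hgm).1
    rw [h1] at h4
    rw [← h2] at hd
    simp only [map_add, degree_single] at h4 hd
    omega
  obtain ⟨j, hj⟩ := exists_single_of_degree_eq_one h3
  rw [hj] at h2
  refine ⟨g - single m 1, m, j, ?_, h1, h2.symm⟩
  by_contra hjm
  have h5 := DFunLike.congr_fun h2 j
  rw [Finsupp.add_apply, Finsupp.single_eq_same, Finsupp.tsub_apply, Finsupp.single_apply] at h5
  rcases Nat.eq_or_lt_of_le (not_lt.1 hjm) with rfl | hlt'
  · rw [if_pos rfl] at h5; omega
  · rw [if_neg (by omega), hpre j hlt'] at h5; omega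

/-- Iterated Borel moves of the variable `x_n`. -/
lemma add_mem_of_add_single_mem {n N : ℕ} {A : Set (ℕ →₀ ℕ)} (h : IsBorelSatSet N A)
    {w r : ℕ →₀ ℕ} (hr : ∀ i, n < i → r i = 0) (hw : w + single n r.degree ∈ A) : w + r ∈ A := by
  induction hd : r.degree generalizing r w with
  | zero => rw [Finsupp.degree_eq_zero_iff] at hd; simpa [hd] using hw
  | succ d ih =>
    have : r ≠ 0 := by rintro rfl; simp at hd
    obtain ⟨i, hi⟩ := Finsupp.ne_iff.1 this
    have hi' : r i ≠ 0 := by simpa using hi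
    have hin : i ≤ n := by
      by_contra hlt
      exact hi' (hr i (by omega))
    have h1 := eq_sub_add_single hi'
    have hdeg : (r - single i 1).degree = d := by
      rw [h1] at hd; simpa using hd
    rw [hd, Finsupp.single_add, ← add_assoc] at hw
    have h2 : w + single n d + single i 1 ∈ A := by
      rcases Nat.eq_or_lt_of_le hin with rfl | hlt
      · exact hw
      · exact h.borel _ i n hlt hw
    rw [h1, add_comm (r - _), ← add_assoc]
    apply ih
    · intro j hj; rw [Finsupp.tsub_apply, hr j hj]; simp
    · rw [hdeg, add_right_comm]; exact h2
    · exact hdeg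

/-- Elements of `J ∖ A` can be divided down to the degrees of the generators of `J`. -/
lemma exists_le_of_mem_diff {A J : Set (ℕ →₀ ℕ)} {N d : ℕ}
    (hA : ∀ u i, u ∈ A → u + single i 1 ∈ A)
    (hJ : ∀ u ∈ J, d < u.degree → ∃ v ∈ J, ∃ i, u = v + single i 1) {s D : ℕ} {u : ℕ →₀ ℕ}
    (hu : u ∈ mons N s) (huJ : u ∈ J) (huA : u ∉ A) (hdD : d ≤ D) (hDs : D ≤ s) :
    ∃ g ∈ mons N D, g ≤ u ∧ g ∈ J ∧ g ∉ A := by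
  induction hk : s - D generalizing s u with
  | zero =>
    obtain rfl : s = D := by omega
    exact ⟨u, hu, le_rfl, huJ, huA⟩
  | succ k ih =>
    obtain ⟨v, hv, i, rfl⟩ := hJ u huJ (by rw [(mem_mons.1 hu).1]; omega)
    have hiN : i < N := by
      by_contra hlt
      have := (mem_mons.1 hu).2 i (by omega)
      simp at this
    obtain ⟨s, rfl⟩ : ∃ t, s = t + 1 := ⟨s - 1, by omega⟩
    obtain ⟨g, h1, h2, h3⟩ := ih ((add_single_mem_mons hiN).1 hu) hv
      (fun h => huA (hA _ _ h)) (by omega) (by omega)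
    exact ⟨g, h1, h2.trans le_self_add, h3⟩

lemma sum_indicator {a b : ℕ} (hab : a ≤ b) (t : ℕ) :
    ∑ s ∈ range t, (if a ≤ s ∧ s < b then 1 else 0) = min t b - min t a := by
  induction t with
  | zero => simp
  | succ t ih =>
    rw [Finset.sum_range_succ, ih]
    split_ifs <;> omega

lemma le_sum_of_pos {q : ℕ → ℕ} {a s : ℕ} (has : a ≤ s) (h : ∀ D, a ≤ D → D ≤ s → 0 < q D) :
    s + 1 - a ≤ ∑ D ∈ range (s + 1), q D := by
  have h1 := sum_indicator (show a ≤ s + 1 by omega) (s + 1)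
  have h2 : ∑ D ∈ range (s + 1), (if a ≤ D ∧ D < s + 1 then 1 else 0) ≤
      ∑ D ∈ range (s + 1), q D := by
    refine Finset.sum_le_sum fun D _ => ?_
    split_ifs with hD
    · exact h D hD.1 (by omega)
    · omega
  omega

lemma le_sum_of_pos_of_extra {q : ℕ → ℕ} {a s x : ℕ} (has : a ≤ s)
    (h : ∀ D, a ≤ D → D ≤ s → 0 < q D) (hx : x ≤ s)
    (hxq : (if a ≤ x then 1 else 0) < q x) :
    s + 2 - a ≤ ∑ D ∈ range (s + 1), q D := by
  have h1 := sum_indicator (show a ≤ s + 1 by omega) (s + 1)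
  have h2 : ∑ D ∈ range (s + 1), ((if a ≤ D ∧ D < s + 1 then 1 else 0) + if D = x then 1 else 0) ≤
      ∑ D ∈ range (s + 1), q D := by
    refine Finset.sum_le_sum fun D hD => ?_
    have := h D
    rw [mem_range] at hD
    split_ifs at hxq ⊢ with h3 h4 h5 <;> subst_vars <;> omega
  rw [Finset.sum_add_distrib, Finset.sum_ite_eq' (range (s + 1)) x, if_pos (by simp; omega)] at h2
  omega

/-- Comparison of a set of monomials `A` with the lexicographic set having the same eventual
Hilbert function. -/
structure LexComparison (n : ℕ) (e : ℕ → ℕ) (A : Set (ℕ →₀ ℕ)) : Prop where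
  le : ∀ t, hilb (lexSet n e) (n + 1) t ≤ hilb A (n + 1) t
  eq_of_le : ∀ t, e 0 ≤ t + 1 → hilb A (n + 1) t = hilb (lexSet n e) (n + 1) t
  of_ne : A ≠ lexSet n e → e 1 < e 0 ∧ 2 ≤ e 0 ∧
    hilb A (n + 1) (e 0 - 2) = hilb (lexSet n e) (n + 1) (e 0 - 2) + 1
  generators : ∀ u ∈ A, e 0 < u.degree → ∃ v ∈ A, ∃ i, u = v + single i 1

lemma sum_hilb_lexSet_succ (n : ℕ) {e : ℕ → ℕ} (he : Antitone e) (h0 : e (n + 1) = 0) (t : ℕ) :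
    ∑ s ∈ range t, hilb (lexSet (n + 1) e) (n + 1) s =
      ∑ s ∈ range t, hilb (lexSet n (fun i => e (i + 1))) (n + 1) s +
        (min t (e 0) - min t (e 1)) := by
  rw [← sum_indicator (he (show 0 ≤ 1 by omega)), ← Finset.sum_add_distrib]
  exact Finset.sum_congr rfl fun s _ => hilb_lexSet_step n he h0 s

section Step

variable {n : ℕ} {e : ℕ → ℕ} {A : Set (ℕ →₀ ℕ)}

lemma eventually_colon (h : IsBorelSatSet (n + 1) A) (he : Antitone e) (h0 : e (n + 1) = 0)
    (hev : ∃ T, ∀ t ≥ T, hilb A (n + 2) t = hilb (lexSet (n + 1) e) (n + 2) t) :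
    ∃ T, ∀ t ≥ T, hilb (colon n A) (n + 1) t =
      hilb (lexSet n (fun i => e (i + 1))) (n + 1) t := by
  obtain ⟨T, hT⟩ := hev
  obtain ⟨D, hD⟩ := h.bounded
  refine ⟨T + 1 + D + e 0, fun t ht => ?_⟩
  obtain ⟨t, rfl⟩ : ∃ t', t = t' + 1 := ⟨t - 1, by omega⟩
  have h1 : hilb A (n + 1 + 1) t = hilb (lexSet (n + 1) e) (n + 1 + 1) t := hT t (by omega)
  have h2 := hT (t + 1) (by omega)
  rw [hilb_succ_succ h.isCyl, hilb_succ_succ (lexSet_isCyl (n + 1) e), h1,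
    hilb_lexSet_step n he h0, if_neg (by omega), hilb_eq_add_diffCount (subset_colon n A)] at h2
  have h3 : diffCount A (colon n A) (n + 1) (t + 1) = 0 := by
    by_contra hne
    obtain ⟨u, hu, huJ, huA⟩ := diffCount_pos.1 (Nat.pos_of_ne_zero hne)
    rw [mem_mons] at hu
    exact huA (mem_of_mem_colon h hD huJ (fun i hi => hu.2 i hi) (by omega))
  omega

lemma sum_colon_add_sum_diffCount (h : IsBorelSatSet (n + 1) A) (he : Antitone e)
    (h0 : e (n + 1) = 0)
    (hev : ∃ T, ∀ t ≥ T, hilb A (n + 2) t = hilb (lexSet (n + 1) e) (n + 2) t) :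
    ∃ T, ∀ t ≥ T, ∑ s ∈ range t, hilb (colon n A) (n + 1) s +
      ∑ s ∈ range t, diffCount A (colon n A) (n + 1) s =
        ∑ s ∈ range t, hilb (lexSet n (fun i => e (i + 1))) (n + 1) s + (e 0 - e 1) := by
  obtain ⟨T, hT⟩ := hev
  have h10 := he (show 0 ≤ 1 by omega)
  refine ⟨T + 1 + e 0, fun t ht => ?_⟩
  obtain ⟨t, rfl⟩ : ∃ t', t = t' + 1 := ⟨t - 1, by omega⟩
  have h1 := hT t (by omega)
  rw [hilb_succ h.isCyl, hilb_succ (lexSet_isCyl (n + 1) e), sum_hilb_lexSet_succ n he h0,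
    min_eq_right (by omega), min_eq_right (by omega)] at h1
  rw [← h1, ← Finset.sum_add_distrib]
  exact Finset.sum_congr rfl fun s _ => (hilb_eq_add_diffCount (subset_colon n A) _ _).symm

/-- The length of `J ∖ A` is at most `e_0 - e_1`. -/
lemma sum_diffCount_le (h : IsBorelSatSet (n + 1) A) (he : Antitone e) (h0 : e (n + 1) = 0)
    (hev : ∃ T, ∀ t ≥ T, hilb A (n + 2) t = hilb (lexSet (n + 1) e) (n + 2) t)
    (hJ : LexComparison n (fun i => e (i + 1)) (colon n A)) (t : ℕ) :
    ∑ s ∈ range t, diffCount A (colon n A) (n + 1) s ≤ e 0 - e 1 := by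
  obtain ⟨T, hT⟩ := sum_colon_add_sum_diffCount h he h0 hev
  have h1 := hT (max T t) (le_max_left _ _)
  have h2 := Finset.sum_le_sum (s := range (max T t)) fun s _ => hJ.le s
  have h3 : ∑ s ∈ range t, diffCount A (colon n A) (n + 1) s ≤
      ∑ s ∈ range (max T t), diffCount A (colon n A) (n + 1) s :=
    Finset.sum_le_sum_of_subset (Finset.range_mono (le_max_right _ _))
  omega

lemma sum_diffCount_lt (h : IsBorelSatSet (n + 1) A) (he : Antitone e) (h0 : e (n + 1) = 0)
    (hev : ∃ T, ∀ t ≥ T, hilb A (n + 2) t = hilb (lexSet (n + 1) e) (n + 2) t)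
    (hJ : LexComparison n (fun i => e (i + 1)) (colon n A))
    (hne : colon n A ≠ lexSet n (fun i => e (i + 1))) (t : ℕ) :
    ∑ s ∈ range t, diffCount A (colon n A) (n + 1) s < e 0 - e 1 := by
  obtain ⟨T, hT⟩ := sum_colon_add_sum_diffCount h he h0 hev
  set M := max T t + e 1 with hM
  obtain ⟨-, h4, h5⟩ := hJ.of_ne hne
  simp only [zero_add] at h4 h5
  have h1 := hT M (by omega)
  have h2 : ∑ s ∈ range M, hilb (lexSet n (fun i => e (i + 1))) (n + 1) s <
      ∑ s ∈ range M, hilb (colon n A) (n + 1) s :=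
    Finset.sum_lt_sum (fun s _ => hJ.le s) ⟨e 1 - 2, by simp; omega, by omega⟩
  have h3 : ∑ s ∈ range t, diffCount A (colon n A) (n + 1) s ≤
      ∑ s ∈ range M, diffCount A (colon n A) (n + 1) s :=
    Finset.sum_le_sum_of_subset (Finset.range_mono (by omega))
  omega

lemma diffCount_pos_of_pos (h : IsBorelSatSet (n + 1) A)
    (hJ : LexComparison n (fun i => e (i + 1)) (colon n A)) {s D : ℕ}
    (hs : 0 < diffCount A (colon n A) (n + 1) s) (hD : e 1 ≤ D) (hDs : D ≤ s) :
    0 < diffCount A (colon n A) (n + 1) D := by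
  obtain ⟨u, hu, huJ, huA⟩ := diffCount_pos.1 hs
  obtain ⟨g, hg, -, hgJ, hgA⟩ := exists_le_of_mem_diff h.up hJ.generators hu huJ huA hD hDs
  exact diffCount_pos.2 ⟨g, hg, hgJ, hgA⟩

lemma sub_le_of_diffCount_pos (h : IsBorelSatSet (n + 1) A) (he : Antitone e)
    (h0 : e (n + 1) = 0)
    (hev : ∃ T, ∀ t ≥ T, hilb A (n + 2) t = hilb (lexSet (n + 1) e) (n + 2) t)
    (hJ : LexComparison n (fun i => e (i + 1)) (colon n A)) {s : ℕ}
    (hs : 0 < diffCount A (colon n A) (n + 1) s) (h1s : e 1 ≤ s) : s + 1 ≤ e 0 := by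
  have h1 := le_sum_of_pos h1s (fun D h1 h2 => diffCount_pos_of_pos h hJ hs h1 h2)
  have h2 := sum_diffCount_le h he h0 hev hJ (s + 1)
  omega

/-- If `J` is lexicographic but `A` is not, then `A` contains a monomial in the difference of
the lexicographic sets, of the largest possible degree. -/
lemma corner_add_mem (h : IsBorelSatSet (n + 1) A)
    (hev : ∃ T, ∀ t ≥ T, hilb A (n + 2) t = hilb (lexSet (n + 1) e) (n + 2) t)
    (hJL : colon n A = lexSet n (fun i => e (i + 1))) (hne : A ≠ lexSet (n + 1) e) :
    e 1 < e 0 ∧ corner n (fun i => e (i + 1)) + single n (e 0 - e 1 - 1) ∈ A := by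
  have hns : ¬ A ⊆ lexSet (n + 1) e := fun hs =>
    hne (eq_of_subset_of_hilb_eq h.isCyl (lexSet_isCyl _ _) hs hev)
  obtain ⟨u, huA, huL⟩ := Set.not_subset.1 hns
  have huJ := subset_colon n A huA
  rw [hJL] at huJ
  rw [mem_lexSet_succ] at huL
  push Not at huL
  obtain ⟨hpre, hlt⟩ := huL huJ
  refine ⟨by omega, ?_⟩
  have h1 := (h.isCyl.trunc_mem_iff u).2 huA
  have h2 := eq_corner_add_of_mem_mons (e := fun i => e (i + 1)) (trunc_mem_mons (n + 1) u)
    (fun i hi => by rw [trunc_apply, if_pos (by omega), hpre i hi])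
  rw [h2, trunc_apply, if_pos (by omega)] at h1
  have h3 : e 0 - e 1 - 1 = u n + (e 0 - e 1 - 1 - u n) := by omega
  rw [h3, Finsupp.single_add, ← add_assoc]
  exact add_mem h.up _ _ h1

lemma diffCount_eq_zero (h : IsBorelSatSet (n + 1) A) (he : Antitone e) (h0 : e (n + 1) = 0)
    (hev : ∃ T, ∀ t ≥ T, hilb A (n + 2) t = hilb (lexSet (n + 1) e) (n + 2) t)
    (hJ : LexComparison n (fun i => e (i + 1)) (colon n A)) (hne : A ≠ lexSet (n + 1) e) {s : ℕ}
    (hs : e 0 ≤ s + 1) : diffCount A (colon n A) (n + 1) s = 0 := by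
  classical
  by_contra hpos
  replace hpos := Nat.pos_of_ne_zero hpos
  by_cases hJL : colon n A = lexSet n (fun i => e (i + 1))
  · obtain ⟨h10, hmem⟩ := corner_add_mem h hev hJL hne
    have he' : Antitone (fun i => e (i + 1)) := fun i j h => he (by omega)
    have hdeg : (corner n (fun i => e (i + 1))).degree = e 1 := by
      rw [degree_corner n he']; simp [h0]
    obtain ⟨u, hu, huJ, huA⟩ := diffCount_pos.1 hpos
    have hle := sum_diffCount_le h he h0 hev hJ (s + 1)
    have hchain : ∀ D, e 1 ≤ D → D ≤ s → 0 < diffCount A (colon n A) (n + 1) D :=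
      fun D h1 h2 => diffCount_pos_of_pos h hJ hpos h1 h2
    obtain ⟨g, hg, hgu, hgJ, hgA⟩ :=
      exists_le_of_mem_diff h.up hJ.generators hu huJ huA (D := e 1) le_rfl (show e 1 ≤ s by omega)
    have hgc : g ≠ corner n (fun i => e (i + 1)) := by
      rintro rfl
      refine huA ?_
      have h1 := add_tsub_cancel_of_le hgu
      rw [← h1]
      apply add_mem_of_add_single_mem h (n := n)
      · intro i hi
        rw [Finsupp.tsub_apply, (mem_mons.1 hu).2 i hi]; simp
      · have h2 := congrArg Finsupp.degree h1
        rw [map_add, hdeg, (mem_mons.1 hu).1] at h2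
        have h3 : (u - corner n (fun i => e (i + 1))).degree =
            (e 0 - e 1 - 1) + (s - e 1 - (e 0 - e 1 - 1)) := by omega
        rw [h3, Finsupp.single_add, ← add_assoc]
        exact add_mem h.up _ _ hmem
    have hmin : ∀ i, g i ≠ 0 → g - single i 1 ∉ lexSet n (fun i => e (i + 1)) := by
      intro i hi hmemL
      have h1 := eq_sub_add_single hi
      rw [← hJL] at hmemL
      have hin : i < n + 1 := by
        by_contra hlt
        exact hi ((mem_mons.1 hg).2 i (by omega))
      have h2 := (mem_mons.1 hg).1
      rw [h1] at h2
      simp only [map_add, degree_single] at h2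
      have h3 : g - single i 1 ∈ mons (n + 1) (e 1 - 1) := by
        rw [← add_single_mem_mons hin, ← h1, show e 1 - 1 + 1 = e 1 by omega]
        exact hg
      have h4 : 0 < diffCount A (colon n A) (n + 1) (e 1 - 1) :=
        diffCount_pos.2 ⟨_, h3, hmemL, fun h' => hgA (by rw [h1]; exact h.up _ _ h')⟩
      have h5 := le_sum_of_pos_of_extra (x := e 1 - 1) (by omega) hchain (by omega)
        (by rw [if_neg (by omega)]; exact h4)
      omega
    rw [hJL] at hgJ
    obtain ⟨w, m, j, hmj, hgw, hcw⟩ := exists_borel_move_corner hgJ hg hdeg hgc hmin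
    have hcA : corner n (fun i => e (i + 1)) ∉ A := by
      intro hcA
      rw [hcw] at hcA
      exact hgA (hgw ▸ h.borel _ _ _ hmj hcA)
    have h2 : 1 < diffCount A (colon n A) (n + 1) (e 1) := by
      unfold diffCount
      rw [Finset.one_lt_card]
      refine ⟨g, ?_, corner n (fun i => e (i + 1)), ?_, hgc⟩
      · rw [mem_filter, hJL]; exact ⟨hg, hgJ, hgA⟩
      · rw [mem_filter, hJL]
        refine ⟨mem_mons.2 ⟨hdeg, fun i hi => corner_of_le _ (by omega)⟩,
          corner_mem_lexSet _ _, hcA⟩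
    have h5 := le_sum_of_pos_of_extra (x := e 1) (by omega) hchain (by omega)
        (by rw [if_pos le_rfl]; exact h2)
    omega
  · have hlt := sum_diffCount_lt h he h0 hev hJ hJL (s + 1)
    have h1 := le_sum_of_pos (show e 1 ≤ s by omega)
      (fun D h1 h2 => diffCount_pos_of_pos h hJ hpos h1 h2)
    omega

lemma step_le (h : IsBorelSatSet (n + 1) A) (he : Antitone e) (h0 : e (n + 1) = 0)
    (hev : ∃ T, ∀ t ≥ T, hilb A (n + 2) t = hilb (lexSet (n + 1) e) (n + 2) t)
    (hJ : LexComparison n (fun i => e (i + 1)) (colon n A)) (t : ℕ) :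
    hilb (lexSet (n + 1) e) (n + 2) t ≤ hilb A (n + 2) t := by
  by_cases hz : ∃ s, e 1 ≤ s ∧ s ≤ t ∧ diffCount A (colon n A) (n + 1) s = 0
  · obtain ⟨s, h1s, hst, hs⟩ := hz
    have hz' : ∀ s' ≥ s, diffCount A (colon n A) (n + 1) s' = 0 := by
      intro s' hs'
      by_contra hne
      exact (diffCount_pos_of_pos h hJ (Nat.pos_of_ne_zero hne) h1s hs').ne' hs
    have hdown : ∀ k, hilb A (n + 1 + 1) (t + k) + hilb (lexSet (n + 1) e) (n + 1 + 1) t ≤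
        hilb A (n + 1 + 1) t + hilb (lexSet (n + 1) e) (n + 1 + 1) (t + k) := by
      intro k
      induction k with
      | zero => simp
      | succ k ih =>
        rw [← add_assoc, hilb_succ_succ h.isCyl, hilb_succ_succ (lexSet_isCyl (n + 1) e),
          hilb_lexSet_step n he h0, hilb_eq_add_diffCount (subset_colon n A) (n + 1) (t + k + 1),
          hz' _ (by omega), hJ.eq_of_le (t + k + 1) (by simp only [zero_add]; omega)]
        omega
    obtain ⟨T, hT⟩ := hev
    have h1 : hilb A (n + 1 + 1) (t + T) = hilb (lexSet (n + 1) e) (n + 1 + 1) (t + T) :=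
      hT (t + T) (by omega)
    have h2 := hdown T
    show hilb (lexSet (n + 1) e) (n + 1 + 1) t ≤ hilb A (n + 1 + 1) t
    omega
  · push Not at hz
    rw [hilb_succ h.isCyl, hilb_succ (lexSet_isCyl (n + 1) e)]
    refine Finset.sum_le_sum fun s hs => ?_
    rw [hilb_lexSet_step n he h0, hilb_eq_add_diffCount (subset_colon n A)]
    have h1 := hJ.le s
    split_ifs with h2
    · have := hz s h2.1 (by simp at hs; omega)
      omega
    · omega

lemma step_eq_of_le (h : IsBorelSatSet (n + 1) A) (he : Antitone e) (h0 : e (n + 1) = 0)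
    (hev : ∃ T, ∀ t ≥ T, hilb A (n + 2) t = hilb (lexSet (n + 1) e) (n + 2) t)
    (hJ : LexComparison n (fun i => e (i + 1)) (colon n A)) (t : ℕ) (ht : e 0 ≤ t + 1) :
    hilb A (n + 1 + 1) t = hilb (lexSet (n + 1) e) (n + 1 + 1) t := by
  by_cases hne : A = lexSet (n + 1) e
  · rw [hne]
  have h10 := he (show 0 ≤ 1 by omega)
  have hdown : ∀ k, hilb A (n + 1 + 1) (t + k) + hilb (lexSet (n + 1) e) (n + 1 + 1) t =
      hilb A (n + 1 + 1) t + hilb (lexSet (n + 1) e) (n + 1 + 1) (t + k) := by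
    intro k
    induction k with
    | zero => simp
    | succ k ih =>
      rw [← add_assoc, hilb_succ_succ h.isCyl, hilb_succ_succ (lexSet_isCyl (n + 1) e),
        hilb_lexSet_step n he h0, hilb_eq_add_diffCount (subset_colon n A) (n + 1) (t + k + 1),
        diffCount_eq_zero h he h0 hev hJ hne (by omega),
        hJ.eq_of_le (t + k + 1) (by simp only [zero_add]; omega), if_neg (by omega)]
      omega
  obtain ⟨T, hT⟩ := hev
  have h1 : hilb A (n + 1 + 1) (t + T) = hilb (lexSet (n + 1) e) (n + 1 + 1) (t + T) :=
    hT (t + T) (by omega)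
  have h2 := hdown T
  omega

lemma step_of_ne (h : IsBorelSatSet (n + 1) A) (he : Antitone e) (h0 : e (n + 1) = 0)
    (hev : ∃ T, ∀ t ≥ T, hilb A (n + 2) t = hilb (lexSet (n + 1) e) (n + 2) t)
    (hJ : LexComparison n (fun i => e (i + 1)) (colon n A)) (hne : A ≠ lexSet (n + 1) e) :
    e 1 < e 0 ∧ 2 ≤ e 0 ∧
      hilb A (n + 1 + 1) (e 0 - 2) = hilb (lexSet (n + 1) e) (n + 1 + 1) (e 0 - 2) + 1 := by
  have h10 : e 1 < e 0 := by
    by_cases hJL : colon n A = lexSet n (fun i => e (i + 1))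
    · exact (corner_add_mem h hev hJL hne).1
    · have := sum_diffCount_lt h he h0 hev hJ hJL 0
      omega
  have h2 : 2 ≤ e 0 := by
    by_cases hJL : colon n A = lexSet n (fun i => e (i + 1))
    · by_contra hlt
      obtain ⟨T, hT⟩ := sum_colon_add_sum_diffCount h he h0 hev
      have h1 := hT T le_rfl
      rw [Finset.sum_eq_zero (fun s _ => diffCount_eq_zero h he h0 hev hJ hne (s := s) (by omega)),
        hJL] at h1
      omega
    · have := (hJ.of_ne hJL).2.1
      simp only [zero_add] at this
      omega
  refine ⟨h10, h2, ?_⟩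
  have h3 := step_eq_of_le h he h0 hev hJ (e 0 - 2 + 1) (by omega)
  rw [hilb_succ_succ h.isCyl, hilb_succ_succ (lexSet_isCyl (n + 1) e),
    hilb_lexSet_step n he h0, hilb_eq_add_diffCount (subset_colon n A) (n + 1) (e 0 - 2 + 1),
    diffCount_eq_zero h he h0 hev hJ hne (by omega),
    hJ.eq_of_le (e 0 - 2 + 1) (by simp only [zero_add]; omega), if_pos (by omega)] at h3
  omega

lemma step_generators (h : IsBorelSatSet (n + 1) A) (he : Antitone e) (h0 : e (n + 1) = 0)
    (hev : ∃ T, ∀ t ≥ T, hilb A (n + 2) t = hilb (lexSet (n + 1) e) (n + 2) t)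
    (hJ : LexComparison n (fun i => e (i + 1)) (colon n A)) (u : ℕ →₀ ℕ) (hu : u ∈ A)
    (hdeg : e 0 < u.degree) : ∃ v ∈ A, ∃ i, u = v + single i 1 := by
  have h10 := he (show 0 ≤ 1 by omega)
  by_cases hs : ∀ i, n + 1 ≤ i → u i = 0
  · obtain ⟨v, hv, i, rfl⟩ := hJ.generators u (subset_colon n A hu) (by simp only [zero_add]; omega)
    refine ⟨v, ?_, i, rfl⟩
    by_contra hvA
    have hin : i < n + 1 := by
      by_contra hlt
      have := hs i (by omega)
      simp at this
    simp only [map_add, degree_single] at hdeg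
    have hvm : v ∈ mons (n + 1) v.degree :=
      (add_single_mem_mons hin).1 (mem_mons.2 ⟨by simp, hs⟩)
    have := sub_le_of_diffCount_pos h he h0 hev hJ (diffCount_pos.2 ⟨v, hvm, hv, hvA⟩) (by omega)
    omega
  · push Not at hs
    obtain ⟨i, hi, hui⟩ := hs
    have h1 := eq_sub_add_single hui
    refine ⟨u - single i 1, h.sat _ i hi ?_, i, h1⟩
    rwa [← h1]

end Step

theorem lexComparison (n : ℕ) {e : ℕ → ℕ} {A : Set (ℕ →₀ ℕ)} (h : IsBorelSatSet n A)
    (he : Antitone e) (h0 : e n = 0)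
    (hev : ∃ T, ∀ t ≥ T, hilb A (n + 1) t = hilb (lexSet n e) (n + 1) t) :
    LexComparison n e A := by
  induction n generalizing e A with
  | zero =>
    have hA : A = lexSet 0 e :=
      eq_of_subset_of_hilb_eq h.isCyl (lexSet_isCyl 0 e) (by simp [lexSet_zero]) hev
    subst hA
    refine ⟨fun t => le_rfl, fun t _ => rfl, fun h => absurd rfl h, fun u _ hu => ?_⟩
    have hne : u ≠ 0 := by rintro rfl; simp at hu
    obtain ⟨i, hi⟩ := Finsupp.ne_iff.1 hne
    exact ⟨u - single i 1, by simp [lexSet_zero], i,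
      eq_sub_add_single (by simpa using hi)⟩
  | succ n ih =>
    have hJ := ih (colon_isBorelSatSet h) (e := fun i => e (i + 1))
      (fun i j hij => he (by omega)) h0 (eventually_colon h he h0 hev)
    exact ⟨step_le h he h0 hev hJ, step_eq_of_le h he h0 hev hJ, step_of_ne h he h0 hev hJ,
      step_generators h he h0 hev hJ⟩

lemma sum_ite_choose (i j t : ℕ) :
    ∑ s ∈ range (t + 1), (if j ≤ s then (s - j + i).choose i else 0) =
      if j ≤ t then (t - j + (i + 1)).choose (i + 1) else 0 := by
  induction t with
  | zero =>
    rcases Nat.eq_zero_or_pos j with rfl | hj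
    · simp
    · simp [hj.ne']
  | succ t ih =>
    rw [Finset.sum_range_succ, ih]
    rcases lt_trichotomy j (t + 1) with h | rfl | h
    · rw [if_pos (by omega), if_pos (by omega), if_pos (by omega),
        show t + 1 - j + (i + 1) = (t - j + (i + 1)) + 1 by omega, Nat.choose_succ_succ,
        show t + 1 - j + i = t - j + (i + 1) by omega, add_comm]
    · rw [if_neg (by omega), if_pos le_rfl, if_pos le_rfl]; simp
    · rw [if_neg (by omega), if_neg (by omega), if_neg (by omega)]

lemma sum_Ico_ite {a b : ℕ} (hab : a ≤ b) (t : ℕ) :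
    ∑ j ∈ Ico a b, (if j ≤ t then 1 else 0) = min (t + 1) b - min (t + 1) a := by
  induction b, hab using Nat.le_induction with
  | base => simp
  | succ b hb ih =>
    rw [Finset.sum_Ico_succ_top hb, ih]
    split_ifs <;> omega

/-- The Hilbert function of the lexicographic set. -/
lemma hilb_lexSet (n : ℕ) {e : ℕ → ℕ} (he : Antitone e) (h0 : e n = 0) (t : ℕ) :
    hilb (lexSet n e) (n + 1) t =
      ∑ i ∈ range n, ∑ j ∈ Ico (e (i + 1)) (e i),
        if j ≤ t then (t - j + i).choose i else 0 := by
  induction n generalizing e t with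
  | zero => simp [hilb, lexSet_zero]
  | succ n ih =>
    have he' : Antitone (fun i => e (i + 1)) := fun i j h => he (by omega)
    have h10 := he (show 0 ≤ 1 by omega)
    rw [hilb_succ (lexSet_isCyl (n + 1) e), sum_hilb_lexSet_succ n he h0,
      Finset.sum_range_succ' _ n]
    simp only [ih he' h0, add_zero, Nat.choose_zero_right, zero_add, sum_Ico_ite h10]
    congr 1
    rw [Finset.sum_comm]
    refine Finset.sum_congr rfl fun i _ => ?_
    rw [Finset.sum_comm]
    exact Finset.sum_congr rfl fun j _ => sum_ite_choose i j t

lemma choose_sub_eq_sum {a b : ℕ} (hab : a ≤ b) (t : ℚ) (i : ℕ) :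
    ∑ j ∈ Ico a b, Ring.choose (t - j + i) i =
      Ring.choose (t + i + 1 - a) (i + 1) - Ring.choose (t + i + 1 - b) (i + 1) := by
  induction b, hab using Nat.le_induction with
  | base => simp
  | succ b hb ih =>
    rw [Finset.sum_Ico_succ_top hb, ih]
    have h := Ring.choose_succ_succ (t - b + i) i
    rw [show t + i + 1 - (b : ℚ) = t - b + i + 1 by ring, h]
    push_cast
    rw [show t + i + 1 - ((b : ℚ) + 1) = t - b + i by ring]
    ring

/-- Two ways of writing the Hilbert polynomial. -/
lemma sum_sub_choose_eq {e : ℕ → ℕ} (he : Antitone e) (n : ℕ) (t : ℚ) :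
    ∑ i ∈ range n, (Ring.choose (t + i) (i + 1) - Ring.choose (t + i - e i) (i + 1)) +
        Ring.choose (t + n - e n) n =
      ∑ i ∈ range n, ∑ j ∈ Ico (e (i + 1)) (e i), Ring.choose (t - j + i) i +
        Ring.choose (t + n) n := by
  induction n with
  | zero => simp
  | succ n ih =>
    rw [Finset.sum_range_succ, Finset.sum_range_succ, choose_sub_eq_sum (he (by omega))]
    have h1 := Ring.choose_succ_succ (t + n) n
    have h2 := Ring.choose_succ_succ (t + n - e n) n
    push_cast
    rw [← add_assoc, h1, show t + n + 1 - (e n : ℚ) = t + n - e n + 1 by ring, h2]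
    linear_combination ih

lemma eval_polyBinom (a : ℤ) (b : ℕ) (t : ℚ) :
    (polyBinom a b).eval t = Ring.choose (t + a) b := by
  rw [polyBinom, if_pos (by omega), Ring.choose_eq_smul]
  simp only [Int.toNat_natCast, Polynomial.eval_smul, Polynomial.eval_comp, Polynomial.eval_add,
    Polynomial.eval_X, Polynomial.eval_C]
  rw [← Polynomial.aeval_eq_smeval, Polynomial.aeval_def, Polynomial.eval₂_eq_eval_map]
  simp

/-- The sequence `e_0, …, e_d, 0, 0, …` of natural numbers. -/
def partNat (d : ℕ) (e : Fin (d + 1) → ℤ) (i : ℕ) : ℕ := (eExt d e i).toNat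

section

variable {d : ℕ} {e : Fin (d + 1) → ℤ}

lemma eExt_nonneg (hepos : ∀ i, 0 < e i) (i : ℕ) : 0 ≤ eExt d e i := by
  unfold eExt
  split_ifs
  · exact (hepos _).le
  · exact le_rfl

lemma partNat_antitone (he : Antitone e) (hepos : ∀ i, 0 < e i) : Antitone (partNat d e) := by
  intro i j hij
  unfold partNat
  apply Int.toNat_le_toNat
  by_cases hj : j ≤ d
  · rw [eExt, eExt, dif_pos hj, dif_pos (hij.trans hj)]
    exact he hij
  · rw [eExt, dif_neg hj]
    exact eExt_nonneg hepos i

lemma partNat_of_lt {i : ℕ} (hi : d < i) : partNat d e i = 0 := by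
  simp [partNat, eExt, Nat.not_le.2 hi]

lemma aSeq_eq (hepos : ∀ i, 0 < e i) (j : ℕ) :
    aSeq d e j = partNat d e j - partNat d e (j + 1) := by
  have h1 := eExt_nonneg hepos j
  have h2 := eExt_nonneg hepos (j + 1)
  unfold aSeq partNat
  omega

lemma eval_mhSum (hepos : ∀ i, 0 < e i) {n : ℕ} (hdn : d < n) (he : Antitone e) (t : ℚ) :
    (mhSum d e).eval t =
      ∑ i ∈ range n, ∑ j ∈ Ico (partNat d e (i + 1)) (partNat d e i),
        Ring.choose (t - j + i) i := by
  have h := sum_sub_choose_eq (partNat_antitone he hepos) n t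
  rw [partNat_of_lt hdn, Nat.cast_zero, sub_zero] at h
  rw [← add_right_cancel h, mhSum, Polynomial.eval_finsetSum]
  rw [← Finset.sum_subset (Finset.range_mono (show d + 1 ≤ n by omega))]
  · rw [Finset.sum_range]
    refine Finset.sum_congr rfl fun i _ => ?_
    have hi : (partNat d e i : ℤ) = e i := by
      have : (i : ℕ) ≤ d := by omega
      rw [partNat, eExt, dif_pos this, Int.toNat_of_nonneg (hepos _).le]
    have hq : (partNat d e i : ℚ) = e i := by exact_mod_cast congrArg (Int.cast : ℤ → ℚ) hi
    have hc : (((i : ℕ) : ℤ) + 1) = ((i + 1 : ℕ) : ℤ) := by push_cast; ring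
    rw [Polynomial.eval_sub, hc, eval_polyBinom, eval_polyBinom, hq]
    push_cast
    rw [add_sub_assoc]
  · intro i _ hi
    rw [partNat_of_lt (by simpa using hi)]
    simp

lemma choose_cast_eq {t j i : ℕ} (h : j ≤ t) :
    (((t - j + i).choose i : ℕ) : ℚ) = Ring.choose ((t : ℚ) - j + i) i := by
  rw [← Ring.choose_natCast]
  push_cast [Nat.cast_sub h]
  rfl

lemma hilb_lexSet_eq_eval (he : Antitone e) (hepos : ∀ i, 0 < e i) {n : ℕ} (hdn : d < n) {t : ℕ}
    (ht : partNat d e 0 ≤ t + 1) :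
    (hilb (lexSet n (partNat d e)) (n + 1) t : ℚ) = (mhSum d e).eval (t : ℚ) := by
  have hanti := partNat_antitone he hepos
  rw [hilb_lexSet n hanti (partNat_of_lt hdn), eval_mhSum hepos hdn he]
  push_cast
  refine Finset.sum_congr rfl fun i _ => Finset.sum_congr rfl fun j hj => ?_
  rw [mem_Ico] at hj
  have := hanti (Nat.zero_le i)
  rw [if_pos (by omega), choose_cast_eq (by omega)]

lemma hilb_lexSet_add_one_eq_eval (he : Antitone e) (hepos : ∀ i, 0 < e i) {n : ℕ} (hdn : d < n)
    (h1 : partNat d e 1 < partNat d e 0) (h2 : 2 ≤ partNat d e 0) :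
    (hilb (lexSet n (partNat d e)) (n + 1) (partNat d e 0 - 2) : ℚ) + 1 =
      (mhSum d e).eval ((partNat d e 0 - 2 : ℕ) : ℚ) := by
  have hanti := partNat_antitone he hepos
  obtain ⟨n, rfl⟩ : ∃ m, n = m + 1 := ⟨n - 1, by omega⟩
  rw [hilb_lexSet _ hanti (partNat_of_lt hdn), eval_mhSum hepos hdn he,
    Finset.sum_range_succ', Finset.sum_range_succ']
  push_cast
  rw [add_assoc]
  congr 1
  · refine Finset.sum_congr rfl fun i _ => Finset.sum_congr rfl fun j hj => ?_
    rw [mem_Ico] at hj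
    have := hanti (show 1 ≤ i + 1 by omega)
    have h3 := choose_cast_eq (t := partNat d e 0 - 2) (j := j) (i := i + 1) (by omega)
    push_cast at h3
    rw [if_pos (by omega), h3]
  · simp only [Nat.choose_zero_right, Nat.cast_one, Ring.choose_zero_right]
    have h3 := sum_Ico_ite h1.le (partNat d e 0 - 2)
    have h4 : (∑ j ∈ Ico (partNat d e 1) (partNat d e 0),
        if j ≤ partNat d e 0 - 2 then (1 : ℚ) else 0) =
        ((partNat d e 0 - 1 - partNat d e 1 : ℕ) : ℚ) := by
      rw [show partNat d e 0 - 1 - partNat d e 1 = ∑ j ∈ Ico (partNat d e 1) (partNat d e 0),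
        if j ≤ partNat d e 0 - 2 then 1 else 0 by rw [h3]; omega]
      push_cast
      rfl
    rw [h4]
    simp only [Finset.sum_const, Nat.card_Ico, nsmul_eq_mul, mul_one]
    rw [← Nat.cast_succ]
    congr 1
    omega

end

section MonomialIdeal

open MvPolynomial

/-- The restriction of an exponent vector to the first `N` variables. -/
noncomputable def res (N : ℕ) (u : ℕ →₀ ℕ) : Fin N →₀ ℕ :=
  Finsupp.equivFunOnFinite.symm fun i => u i

@[simp] lemma res_apply {N : ℕ} (u : ℕ →₀ ℕ) (i : Fin N) : res N u i = u i := rfl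

lemma res_add {N : ℕ} (u v : ℕ →₀ ℕ) : res N (u + v) = res N u + res N v := by
  ext i; simp

lemma res_single {N : ℕ} (i : Fin N) (a : ℕ) : res N (single (i : ℕ) a) = single i a := by
  ext j; simp [Finsupp.single_apply, Fin.ext_iff]

lemma res_single_of_le {N i : ℕ} (hi : N ≤ i) (a : ℕ) : res N (single i a) = 0 := by
  ext j
  rw [res_apply, Finsupp.single_apply, if_neg (by omega), Finsupp.zero_apply]

lemma exists_res_eq {N : ℕ} (v : Fin N →₀ ℕ) : ∃ u, res N u = v ∧ ∀ i, N ≤ i → u i = 0 := by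
  refine ⟨v.embDomain Fin.valEmbedding, ?_, fun i hi => ?_⟩
  · ext i
    exact Finsupp.embDomain_apply_self Fin.valEmbedding v i
  · refine Finsupp.embDomain_of_notMem_range _ _ _ ?_
    rintro ⟨j, rfl⟩
    exact absurd j.2 (Nat.not_lt.2 hi)

lemma res_injOn {N : ℕ} {u v : ℕ →₀ ℕ} (hu : ∀ i, N ≤ i → u i = 0) (hv : ∀ i, N ≤ i → v i = 0)
    (h : res N u = res N v) : u = v := by
  ext i
  rcases lt_or_ge i N with hi | hi
  · exact DFunLike.congr_fun h (⟨i, hi⟩ : Fin N)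
  · rw [hu i hi, hv i hi]

lemma degree_res {N : ℕ} {u : ℕ →₀ ℕ} (hu : ∀ i, N ≤ i → u i = 0) :
    (res N u).degree = u.degree := by
  rw [Finsupp.degree_eq_sum, Finsupp.degree_apply]
  simp only [res_apply]
  rw [Fin.sum_univ_eq_sum_range (fun i => u i) N]
  symm
  refine Finset.sum_subset (fun i hi => ?_) (fun i _ hi => by simpa using hi)
  rw [mem_range]
  by_contra hlt
  exact (Finsupp.mem_support_iff.1 hi) (hu i (by omega))

variable {k : Type*} [Field k] {N : ℕ} {I : Ideal (MvPolynomial (Fin N) k)}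

lemma mem_iff_of_isMonomialIdeal (hI : IsMonomialIdeal I) {f : MvPolynomial (Fin N) k} :
    f ∈ I ↔ ∀ v ∈ f.support, monomial v (1 : k) ∈ I := by
  obtain ⟨S, rfl⟩ := hI
  classical
  simp only [mem_ideal_span_monomial_image, support_monomial, one_ne_zero, if_false,
    Finset.mem_singleton, forall_eq]

lemma monomial_mem_of_le {v w : Fin N →₀ ℕ} (hvw : v ≤ w) (hv : monomial v (1 : k) ∈ I) :
    monomial w (1 : k) ∈ I := by
  have h : monomial w (1 : k) = monomial (w - v) 1 * monomial v 1 := by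
    rw [monomial_mul, mul_one, tsub_add_cancel_of_le hvw]
  rw [h]
  exact I.mul_mem_left _ hv

/-- The exponent vectors of the monomials of `I`, up to the variables `x_j` with `j ≥ N`. -/
def monSet (I : Ideal (MvPolynomial (Fin N) k)) : Set (ℕ →₀ ℕ) :=
  {u | monomial (res N u) (1 : k) ∈ I}

lemma mem_monSet {u : ℕ →₀ ℕ} : u ∈ monSet I ↔ monomial (res N u) (1 : k) ∈ I := Iff.rfl

lemma eq_of_monSet_eq {J : Ideal (MvPolynomial (Fin N) k)} (hI : IsMonomialIdeal I)
    (hJ : IsMonomialIdeal J) (h : monSet I = monSet J) : I = J := by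
  ext f
  rw [mem_iff_of_isMonomialIdeal hI, mem_iff_of_isMonomialIdeal hJ]
  refine forall₂_congr fun v _ => ?_
  obtain ⟨u, rfl, -⟩ := exists_res_eq v
  rw [← mem_monSet, ← mem_monSet, h]

open Classical in
/-- The Hilbert function of a monomial ideal counts its standard monomials. -/
lemma hilbFn_eq_hilb (hI : IsMonomialIdeal I) (t : ℕ) : hilbFn I t = hilb (monSet I) N t := by
  set T := {u ∈ mons N t | u ∉ monSet I} with hT
  have hTmem : ∀ u ∈ T, u.degree = t ∧ (∀ i, N ≤ i → u i = 0) ∧ u ∉ monSet I := by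
    intro u hu
    rw [hT, Finset.mem_filter, mem_mons] at hu
    exact ⟨hu.1.1, hu.1.2, hu.2⟩
  let φ : homogeneousSubmodule (Fin N) k t →ₗ[k] (T → k) :=
    (LinearMap.pi fun u : T => lcoeff k (res N (u : ℕ →₀ ℕ))).comp (Submodule.subtype _)
  have hφ : ∀ f u, φ f u = coeff (res N (u : ℕ →₀ ℕ)) (f : MvPolynomial (Fin N) k) :=
    fun _ _ => rfl
  have hker : Submodule.comap (homogeneousSubmodule (Fin N) k t).subtype
      (Submodule.restrictScalars k I) = LinearMap.ker φ := by
    ext f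
    have hf : (f : MvPolynomial (Fin N) k).IsHomogeneous t := f.2
    rw [Submodule.mem_comap, Submodule.restrictScalars_mem, LinearMap.mem_ker,
      Submodule.subtype_apply, mem_iff_of_isMonomialIdeal hI]
    constructor
    · intro h
      funext u
      rw [hφ, Pi.zero_apply]
      by_contra hne
      exact (hTmem u u.2).2.2 (h _ (MvPolynomial.mem_support_iff.2 hne))
    · intro h v hv
      obtain ⟨u, rfl, hu⟩ := exists_res_eq v
      by_contra hne
      rw [MvPolynomial.mem_support_iff] at hv
      have hdeg : u.degree = t := by
        rw [← degree_res hu]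
        by_contra hd
        exact hv (hf.coeff_eq_zero hd)
      have huT : u ∈ T := Finset.mem_filter.2 ⟨mem_mons.2 ⟨hdeg, hu⟩, hne⟩
      exact hv (congrFun h ⟨u, huT⟩)
  have hsurj : Function.Surjective φ := by
    intro g
    refine ⟨∑ u : T, ⟨monomial (res N (u : ℕ →₀ ℕ)) (g u), isHomogeneous_monomial _ ?_⟩, ?_⟩
    · rw [degree_res (hTmem u u.2).2.1, (hTmem u u.2).1]
    · funext w
      rw [hφ, Submodule.coe_sum, coeff_sum, Finset.sum_eq_single w]
      · simp
      · intro u _ huw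
        rw [coeff_monomial, if_neg]
        exact fun h => huw (Subtype.ext (res_injOn (hTmem u u.2).2.1 (hTmem w w.2).2.1 h))
      · simp
  rw [hilbFn, hker, (φ.quotKerEquivOfSurjective hsurj).finrank_eq,
    Module.finrank_fintype_fun_eq_card, Fintype.card_coe]
  rfl

lemma isBorelSatSet_monSet {n : ℕ} {I : Ideal (MvPolynomial (Fin (n + 1)) k)}
    (hB : IsBorel I) (hS : IsSaturatedIdeal I) : IsBorelSatSet n (monSet I) := by
  have hup : ∀ u i, u ∈ monSet I → u + single i 1 ∈ monSet I := by
    intro u i hu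
    refine monomial_mem_of_le ?_ hu
    rw [res_add]
    exact le_self_add
  have hbig : ∀ u i, n + 1 ≤ i → (u + single i 1 ∈ monSet I ↔ u ∈ monSet I) := by
    intro u i hi
    rw [mem_monSet, res_add, res_single_of_le hi, add_zero, mem_monSet]
  have hborel : ∀ u i j, i < j → u + single j 1 ∈ monSet I → u + single i 1 ∈ monSet I := by
    intro u i j hij hu
    rcases lt_or_ge j (n + 1) with hj | hj
    · rw [mem_monSet, res_add, res_single (⟨j, hj⟩ : Fin (n + 1))] at hu
      have h := hB _ hu ⟨j, hj⟩ (by simp) ⟨i, hij.trans hj⟩ hij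
      rw [add_tsub_cancel_right] at h
      rw [mem_monSet, res_add, res_single (⟨i, hij.trans hj⟩ : Fin (n + 1))]
      exact h
    · exact hup _ _ ((hbig u j hj).1 hu)
  refine ⟨hup, hborel, fun u j hj hu => ?_, ?_⟩
  · rcases hj.eq_or_lt with rfl | hj
    · refine hS _ ⟨1, le_rfl, fun g hg => ?_⟩
      rw [pow_one] at hg
      induction hg using Submodule.span_induction with
      | mem x hx =>
        obtain ⟨i, rfl⟩ := hx
        have hi : u + single (i : ℕ) 1 ∈ monSet I := by
          rcases (Nat.lt_succ_iff.1 i.2).eq_or_lt with h | h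
          · rw [h]; exact hu
          · exact hborel u i n h hu
        rw [mem_monSet, res_add, res_single] at hi
        rwa [X, monomial_mul, mul_one]
      | zero => rw [mul_zero]; exact I.zero_mem
      | add x y _ _ hx hy => rw [mul_add]; exact I.add_mem hx hy
      | smul a x _ hx =>
        rw [smul_eq_mul, mul_left_comm]
        exact I.mul_mem_left _ hx
    · exact (hbig u j hj).1 hu
  · have hfin : {v | Minimal (fun v : Fin (n + 1) →₀ ℕ => monomial v (1 : k) ∈ I) v}.Finite :=
      WellQuasiOrderedLE.finite_of_isAntichain (setOfPred_minimal_antichain _)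
    obtain ⟨D, hD⟩ := (hfin.image Finsupp.degree).bddAbove
    refine ⟨D, fun u hu huD => ?_⟩
    by_cases hu0 : ∀ i, n + 1 ≤ i → u i = 0
    · have hmin : ¬ Minimal (fun v : Fin (n + 1) →₀ ℕ => monomial v (1 : k) ∈ I) (res _ u) := by
        intro h
        have := hD (Set.mem_image_of_mem _ h)
        rw [degree_res hu0] at this
        omega
      obtain ⟨w, hw, hwI⟩ := (not_minimal_iff_exists_lt
        (P := fun v : Fin (n + 1) →₀ ℕ => monomial v (1 : k) ∈ I) hu).1 hmin
      obtain ⟨i, hi⟩ : ∃ i, w i < u (i : ℕ) := by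
        by_contra! hcon
        exact hw.not_ge fun i => hcon i
      refine ⟨u - single (i : ℕ) 1, ?_, i, eq_sub_add_single (by omega)⟩
      refine monomial_mem_of_le (fun j => ?_) hwI
      have hj : w j ≤ u (j : ℕ) := hw.le j
      rw [res_apply, Finsupp.tsub_apply, Finsupp.single_apply]
      split_ifs with hij
      · rw [Fin.ext hij] at hi
        omega
      · exact hj
    · push Not at hu0
      obtain ⟨i, hi, hui⟩ := hu0
      have h := eq_sub_add_single (u := u) (i := i) (by omega)
      refine ⟨u - single i 1, ?_, i, h⟩
      rw [h] at hu
      exact (hbig _ i hi).1 hu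

lemma isMonomialIdeal_lexIdealGen (n : ℕ) (a : ℕ → ℕ) :
    IsMonomialIdeal (lexIdealGen k n a) := by
  refine ⟨lexExp n a '' {m | m < n}, ?_⟩
  rw [lexIdealGen, Set.image_image]

lemma lexExp_le_res {n m : ℕ} {a : ℕ → ℕ} (hm : m < n) {u : ℕ →₀ ℕ} :
    lexExp n a m ≤ res (n + 1) u ↔ (∀ i < m, a (n - 1 - i) ≤ u i) ∧
      (if m = n - 1 then a 0 else a (n - 1 - m) + 1) ≤ u m := by
  constructor
  · intro h
    constructor
    · intro i hi
      have := h (⟨i, by omega⟩ : Fin (n + 1))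
      simpa [lexExp, hi] using this
    · have := h (⟨m, by omega⟩ : Fin (n + 1))
      simpa [lexExp] using this
  · rintro ⟨h1, h2⟩ i
    simp only [lexExp, Finsupp.equivFunOnFinite_symm_apply_apply, res_apply]
    rcases lt_trichotomy (i : ℕ) m with hi | hi | hi
    · rw [if_pos hi]; exact h1 _ hi
    · rw [if_neg (by omega), if_pos hi, hi]; exact h2
    · rw [if_neg (by omega), if_neg (by omega)]; exact Nat.zero_le _

lemma monSet_lexIdealGen {n : ℕ} (hn : 0 < n) {a e : ℕ → ℕ}
    (ha : ∀ j, a j = e j - e (j + 1)) : monSet (lexIdealGen k n a) = lexSet n e := by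
  classical
  have hc : ∀ i < n, corner n e i = a (n - 1 - i) := by
    intro i hi
    rw [corner_apply, if_pos hi, ha]
    congr 2
    omega
  ext u
  have hmem : u ∈ monSet (lexIdealGen k n a) ↔ ∃ m < n, lexExp n a m ≤ res (n + 1) u := by
    have h := mem_ideal_span_monomial_image (R := k) (x := monomial (res (n + 1) u) (1 : k))
      (s := lexExp n a '' {m | m < n})
    rw [Set.image_image] at h
    rw [mem_monSet, lexIdealGen, h]
    simp [support_monomial]
  rw [hmem]
  constructor
  · rintro ⟨m, hm, hle⟩ m' hm' hpre
    rw [lexExp_le_res hm] at hle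
    rw [hc m' hm']
    rcases lt_trichotomy m' m with h | rfl | h
    · exact hle.1 _ h
    · have := hle.2
      split_ifs at this with heq
      · rwa [heq, Nat.sub_self, ← heq]
      · omega
    · have h1 := hle.2
      rw [if_neg (by omega), hpre m h, hc m hm] at h1
      omega
  · intro hu
    by_cases hall : ∀ m < n, u m = corner n e m
    · refine ⟨n - 1, by omega, (lexExp_le_res (by omega)).2 ⟨fun i hi => ?_, ?_⟩⟩
      · rw [hall i (by omega), hc i (by omega)]
      · rw [if_pos rfl, hall _ (by omega), hc _ (by omega), Nat.sub_self]
    · push Not at hall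
      have hlt := Nat.find_spec hall
      have hmin := fun i (hi : i < Nat.find hall) => Nat.find_min hall hi
      set m := Nat.find hall
      have hpre : ∀ i < m, u i = corner n e i := fun i hi => by
        by_contra hne
        exact hmin i hi ⟨hi.trans hlt.1, hne⟩
      have hge := hu m hlt.1 hpre
      rw [hc m hlt.1] at hge
      have hne := hlt.2
      rw [hc m hlt.1] at hne
      refine ⟨m, hlt.1, (lexExp_le_res hlt.1).2 ⟨fun i hi => ?_, ?_⟩⟩
      · rw [hpre i hi, hc i (by omega)]
      · split_ifs with heq
        · rwa [heq, Nat.sub_self, ← heq] at hge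
        · omega

end MonomialIdeal

end BorelSet

/-- If `I` is a saturated Borel monomial ideal with Hilbert polynomial `p` of degree
`d < n` (Macaulay–Hartshorne partition `e_0 ≥ … ≥ e_d > 0`) and `I ≠ L^p_n`, then there
is an integer `m` such that the Hilbert function of `I` agrees with `p` from `m` on, while
the Hilbert function of `L^p_n` differs from `p` at `m`. -/
theorem statement_16 (k : Type*) [Field k] (n d : ℕ) (hdn : d < n)
    (I : Ideal (MvPolynomial (Fin (n + 1)) k))
    (hmon : IsMonomialIdeal I) (hborel : IsBorel I) (hsat : IsSaturatedIdeal I)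
    (e : Fin (d + 1) → ℤ) (he : Antitone e) (hepos : ∀ i, 0 < e i)
    (hp : ∃ N : ℕ, ∀ i : ℕ, N ≤ i → (hilbFn I i : ℚ) = (mhSum d e).eval (i : ℚ))
    (hne : I ≠ lexIdealGen k n (aSeq d e)) :
    ∃ m : ℕ,
      (∀ j : ℕ, m ≤ j → (hilbFn I j : ℚ) = (mhSum d e).eval (j : ℚ)) ∧
      (hilbFn (lexIdealGen k n (aSeq d e)) m : ℚ) ≠ (mhSum d e).eval (m : ℚ) := by
  have hanti := BorelSet.partNat_antitone he hepos
  have hn0 : BorelSet.partNat d e n = 0 := BorelSet.partNat_of_lt hdn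
  have hI := fun t => BorelSet.hilbFn_eq_hilb hmon t
  have hlexmon := BorelSet.isMonomialIdeal_lexIdealGen (k := k) n (aSeq d e)
  have hlexset : BorelSet.monSet (lexIdealGen k n (aSeq d e)) =
      BorelSet.lexSet n (BorelSet.partNat d e) :=
    BorelSet.monSet_lexIdealGen (by omega) (BorelSet.aSeq_eq hepos)
  have hcmp := BorelSet.lexComparison n (BorelSet.isBorelSatSet_monSet hborel hsat) hanti hn0 (by
    obtain ⟨T, hT⟩ := hp
    refine ⟨max T (BorelSet.partNat d e 0), fun t ht => ?_⟩
    have h1 := hT t (by omega)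
    rw [hI, ← BorelSet.hilb_lexSet_eq_eval he hepos hdn (by omega)] at h1
    exact_mod_cast h1)
  have hneset : BorelSet.monSet I ≠ BorelSet.lexSet n (BorelSet.partNat d e) := fun h =>
    hne (BorelSet.eq_of_monSet_eq hmon hlexmon (h.trans hlexset.symm))
  obtain ⟨h10, h2, heq⟩ := hcmp.of_ne hneset
  have hval := BorelSet.hilb_lexSet_add_one_eq_eval he hepos hdn h10 h2
  refine ⟨BorelSet.partNat d e 0 - 2, fun j hj => ?_, ?_⟩
  · rw [hI]
    rcases hj.eq_or_lt with rfl | hj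
    · rw [heq, ← hval]
      push_cast
      rfl
    · rw [hcmp.eq_of_le j (by omega), BorelSet.hilb_lexSet_eq_eval he hepos hdn (by omega)]
  · rw [BorelSet.hilbFn_eq_hilb hlexmon, hlexset, ← hval]
    exact (lt_add_one _).ne
end
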